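/- arXiv:1501.07876 — 2 statements merged into one kernel-verified Lean document; each statement's English description precedes it below -/
import Mathlib

section
/- Let A be a self-adjoint operator with domain D(A) on a Hilbert space H, and let U be a unitary operator on H of class C¹(A) with commutator B₀ = ad_A U. Suppose U*B₀ = B + K where B is a bounded operator commuting with U and K is compact. Let φ ∈ H and ψ ∈ D(A), and assume that at least one of φ, ψ belongs to H_c(U). Then lim_{n→∞} n^{−1}·⟨U^nφ, A(U^nψ)⟩ = ⟨φ, Bψ⟩ and lim_{n→∞} n^{−1}·⟨U^{*n}φ, A(U^{*n}ψ)⟩ = −⟨φ, Bψ⟩. -/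
open scoped ComplexInnerProductSpace
open Filter

section Helpers

variable {H : Type*} [NormedAddCommGroup H] [InnerProductSpace ℂ H]

/-- The Cesàro mean of `‖⟪u j, v⟫‖ ^ 2` over `j < n`. -/
noncomputable def meanSqInner (u : ℕ → H) (v : H) (n : ℕ) : ℝ :=
  (n : ℝ)⁻¹ * ∑ j ∈ Finset.range n, ‖⟪u j, v⟫‖ ^ 2

/-- The Cesàro mean of the rank-one operators `|u j⟩⟨u j|` over `j < n`. -/
noncomputable def meanRankOne (u : ℕ → H) (n : ℕ) : H →L[ℂ] H :=
  (n : ℂ)⁻¹ • ∑ j ∈ Finset.range n, InnerProductSpace.rankOne ℂ (u j) (u j)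

theorem meanSqInner_nonneg (u : ℕ → H) (v : H) (n : ℕ) : 0 ≤ meanSqInner u v n := by
  unfold meanSqInner; positivity

theorem inv_natCast_mul_sum_le {f : ℕ → ℝ} {C : ℝ} (hC : 0 ≤ C) (hf : ∀ j, f j ≤ C) (n : ℕ) :
    (n : ℝ)⁻¹ * ∑ j ∈ Finset.range n, f j ≤ C := by
  rcases Nat.eq_zero_or_pos n with rfl | hn
  · simpa using hC
  · have h : ∑ j ∈ Finset.range n, f j ≤ n * C := by
      simpa using Finset.sum_le_card_nsmul (Finset.range n) f C fun j _ => hf j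
    rw [inv_mul_le_iff₀ (by positivity)]
    exact h

theorem meanSqInner_le {u : ℕ → H} {c : ℝ} (hu : ∀ j, ‖u j‖ = c) (v : H) (n : ℕ) :
    meanSqInner u v n ≤ c ^ 2 * ‖v‖ ^ 2 := by
  refine inv_natCast_mul_sum_le (by positivity) (fun j => ?_) n
  rw [← mul_pow, ← hu j]
  gcongr
  exact norm_inner_le_norm _ _

theorem norm_mean_inner_mul_inner_sq_le (u u' : ℕ → H) (v w : H) (n : ℕ) :
    ‖(n : ℂ)⁻¹ * ∑ j ∈ Finset.range n, ⟪v, u j⟫ * ⟪u' j, w⟫‖ ^ 2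
      ≤ meanSqInner u v n * meanSqInner u' w n := by
  have h1 : ‖∑ j ∈ Finset.range n, ⟪v, u j⟫ * ⟪u' j, w⟫‖
      ≤ ∑ j ∈ Finset.range n, ‖⟪u j, v⟫‖ * ‖⟪u' j, w⟫‖ := by
    refine (norm_sum_le _ _).trans_eq (Finset.sum_congr rfl fun j _ => ?_)
    rw [norm_mul, norm_inner_symm]
  have h2 := Finset.sum_mul_sq_le_sq_mul_sq (Finset.range n)
    (fun j => ‖⟪u j, v⟫‖) (fun j => ‖⟪u' j, w⟫‖)
  rw [norm_mul, mul_pow, norm_inv, Complex.norm_natCast]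
  unfold meanSqInner
  calc _ ≤ ((n : ℝ)⁻¹) ^ 2 * (∑ j ∈ Finset.range n, ‖⟪u j, v⟫‖ * ‖⟪u' j, w⟫‖) ^ 2 := by gcongr
    _ ≤ ((n : ℝ)⁻¹) ^ 2 * ((∑ j ∈ Finset.range n, ‖⟪u j, v⟫‖ ^ 2) *
          ∑ j ∈ Finset.range n, ‖⟪u' j, w⟫‖ ^ 2) := by gcongr
    _ = _ := by ring

theorem inner_meanRankOne (u : ℕ → H) (n : ℕ) (v w : H) :
    ⟪meanRankOne u n v, w⟫ = (n : ℂ)⁻¹ * ∑ j ∈ Finset.range n, ⟪v, u j⟫ * ⟪u j, w⟫ := by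
  simp [meanRankOne, mul_comm]

theorem inner_meanRankOne_self (u : ℕ → H) (n : ℕ) (v : H) :
    ⟪meanRankOne u n v, v⟫ = (meanSqInner u v n : ℂ) := by
  rw [inner_meanRankOne, meanSqInner]
  push_cast
  congr 1
  refine Finset.sum_congr rfl fun j _ => ?_
  rw [← inner_conj_symm v (u j)]
  exact RCLike.conj_mul _

theorem norm_inner_meanRankOne_sq_le {u : ℕ → H} {c : ℝ} (hu : ∀ j, ‖u j‖ = c) (n : ℕ)
    (v w : H) :
    ‖⟪meanRankOne u n v, w⟫‖ ^ 2 ≤ meanSqInner u v n * (c ^ 2 * ‖w‖ ^ 2) := by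
  rw [inner_meanRankOne]
  exact (norm_mean_inner_mul_inner_sq_le u u v w n).trans
    (mul_le_mul_of_nonneg_left (meanSqInner_le hu w n) (meanSqInner_nonneg u v n))

theorem norm_inner_meanRankOne_le {u : ℕ → H} {c : ℝ} (hu : ∀ j, ‖u j‖ = c) (n : ℕ) (v w : H) :
    ‖⟪meanRankOne u n v, w⟫‖ ≤ c ^ 2 * ‖v‖ * ‖w‖ := by
  refine (pow_le_pow_iff_left₀ (by positivity) (by positivity) two_ne_zero).1 ?_
  refine (norm_inner_meanRankOne_sq_le hu n v w).trans ?_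
  calc _ ≤ (c ^ 2 * ‖v‖ ^ 2) * (c ^ 2 * ‖w‖ ^ 2) := by
        gcongr
        exact meanSqInner_le hu v n
    _ = _ := by ring

theorem sum_meanSqInner_le {u : ℕ → H} {c : ℝ} (hu : ∀ j, ‖u j‖ = c) {s : Finset H}
    (hs : Orthonormal ℂ ((↑) : s → H)) (n : ℕ) :
    ∑ e ∈ s, meanSqInner u e n ≤ c ^ 2 := by
  unfold meanSqInner
  rw [← Finset.mul_sum, Finset.sum_comm]
  refine inv_natCast_mul_sum_le (by positivity) (fun j => ?_) n
  have h := hs.sum_inner_products_le (u j) (s := Finset.univ)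
  rw [hu j, Finset.sum_coe_sort s (fun e => ‖⟪e, u j⟫‖ ^ 2)] at h
  simpa only [norm_inner_symm] using h

/-- A bounded family of sesquilinear forms has a weak limit along every ultrafilter. -/
theorem exists_tendsto_inner_ultrafilter [CompleteSpace H] {ι : Type*} (F : Ultrafilter ι)
    (S : ι → H →L[ℂ] H) {C : ℝ} (hS : ∀ i v w, ‖⟪S i v, w⟫‖ ≤ C * ‖v‖ * ‖w‖) :
    ∃ T : H →L[ℂ] H, ∀ v w, Tendsto (fun i => ⟪S i v, w⟫) F (nhds ⟪T v, w⟫) := by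
  have hex : ∀ v w, ∃ l : ℂ, Tendsto (fun i => ⟪S i v, w⟫) F (nhds l) := by
    intro v w
    obtain ⟨l, -, hl⟩ := (isCompact_closedBall (0 : ℂ) (C * ‖v‖ * ‖w‖)).ultrafilter_le_nhds
      (F.map fun i => ⟪S i v, w⟫) (by
        exact tendsto_principal.2 (Eventually.of_forall fun i =>
          mem_closedBall_zero_iff.2 (hS i v w)))
    exact ⟨l, hl⟩
  choose l hl using hex
  let L : H →ₗ⋆[ℂ] H →ₗ[ℂ] ℂ := LinearMap.mk₂'ₛₗ (starRingEnd ℂ) (RingHom.id ℂ) l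
    (fun a b w => tendsto_nhds_unique (hl (a + b) w) (by
      simpa [inner_add_left] using (hl a w).add (hl b w)))
    (fun c a w => tendsto_nhds_unique (hl (c • a) w) (by
      simpa [inner_smul_left, mul_comm] using (hl a w).const_mul (starRingEnd ℂ c)))
    (fun a b w => tendsto_nhds_unique (hl a (b + w)) (by
      simpa [inner_add_right] using (hl a b).add (hl a w)))
    (fun c a w => tendsto_nhds_unique (hl a (c • w)) (by
      simpa [inner_smul_right] using (hl a w).const_mul c))
  have hL : ∀ v w, ‖L v w‖ ≤ C * ‖v‖ * ‖w‖ := fun v w =>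
    le_of_tendsto (hl v w).norm (Eventually.of_forall fun i => hS i v w)
  refine ⟨InnerProductSpace.continuousLinearMapOfBilin (L.mkContinuous₂ C hL), fun v w => ?_⟩
  rw [InnerProductSpace.continuousLinearMapOfBilin_apply]
  exact hl v w

theorem exists_finset_re_inner_le_of_trace_bound {T : H →L[ℂ] H} {M : ℝ}
    (hM : ∀ s : Finset H, Orthonormal ℂ ((↑) : s → H) → ∑ e ∈ s, (⟪T e, e⟫).re ≤ M)
    {ε : ℝ} (hε : 0 < ε) :
    ∃ s : Finset H, ∀ x ∈ (Submodule.span ℂ (s : Set H))ᗮ, (⟪T x, x⟫).re ≤ ε * ‖x‖ ^ 2 := by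
  classical
  let R : Set ℝ := {r | ∃ s : Finset H, Orthonormal ℂ ((↑) : s → H) ∧ ∑ e ∈ s, (⟪T e, e⟫).re = r}
  have hbdd : BddAbove R := ⟨M, by rintro _ ⟨s, hs, rfl⟩; exact hM s hs⟩
  have hne : R.Nonempty := ⟨0, ∅, ⟨fun i => absurd i.2 (Finset.notMem_empty _),
    fun i => absurd i.2 (Finset.notMem_empty _)⟩, by simp⟩
  obtain ⟨_, ⟨s, hs, rfl⟩, hlt⟩ := exists_lt_of_lt_csSup hne (sub_lt_self (sSup R) hε)
  refine ⟨s, fun x hx => ?_⟩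
  have hunit : ∀ y ∈ (Submodule.span ℂ (s : Set H))ᗮ, ‖y‖ = 1 → (⟪T y, y⟫).re ≤ ε := by
    intro y hy hy1
    have hperp : ∀ e ∈ s, ⟪e, y⟫ = 0 := fun e he => hy e (Submodule.subset_span he)
    have hys : y ∉ s := by
      intro h
      have h0 := hperp y h
      rw [inner_self_eq_zero] at h0
      simp [h0] at hy1
    have hins : Orthonormal ℂ (Subtype.val : {a // a ∈ insert y s} → H) := by
      refine ⟨?_, ?_⟩
      · rintro ⟨a, ha⟩
        rcases Finset.mem_insert.1 ha with rfl | ha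
        · exact hy1
        · exact hs.1 ⟨a, ha⟩
      · rintro ⟨a, ha⟩ ⟨b, hb⟩ hab
        have hab' : a ≠ b := fun h => hab (Subtype.ext h)
        rcases Finset.mem_insert.1 ha with rfl | has <;>
          rcases Finset.mem_insert.1 hb with rfl | hbs
        · exact absurd rfl hab'
        · exact inner_eq_zero_symm.1 (hperp b hbs)
        · exact hperp a has
        · exact hs.2 (i := ⟨a, has⟩) (j := ⟨b, hbs⟩) fun h => hab' (congrArg Subtype.val h)
    have hle := le_csSup hbdd ⟨insert y s, hins, rfl⟩
    rw [Finset.sum_insert hys] at hle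
    linarith
  rcases eq_or_ne x 0 with rfl | hx0
  · simp
  · have hxn : 0 < ‖x‖ := norm_pos_iff.2 hx0
    have h := hunit (((‖x‖⁻¹ : ℝ) : ℂ) • x) (Submodule.smul_mem _ _ hx) (by
      rw [norm_smul, Complex.norm_real, norm_inv, norm_norm, inv_mul_cancel₀ hxn.ne'])
    rw [map_smul, inner_smul_left, inner_smul_right, Complex.conj_ofReal, Complex.re_ofReal_mul,
      Complex.re_ofReal_mul, ← mul_assoc, ← mul_inv, inv_mul_le_iff₀ (by positivity)] at h
    linarith

/-- An operator with bounded diagonal sums, controlled by its quadratic form, is compact. -/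
theorem isCompactOperator_of_trace_bound [CompleteSpace H] {T : H →L[ℂ] H} {M C : ℝ} (hC : 0 ≤ C)
    (hM : ∀ s : Finset H, Orthonormal ℂ ((↑) : s → H) → ∑ e ∈ s, (⟪T e, e⟫).re ≤ M)
    (hT : ∀ x, ‖T x‖ ^ 2 ≤ C * (⟪T x, x⟫).re) : IsCompactOperator T := by
  have hmem : T ∈ closure {f : H →L[ℂ] H | IsCompactOperator f} := by
    rw [Metric.mem_closure_iff]
    intro δ hδ
    obtain ⟨s, hs⟩ := exists_finset_re_inner_le_of_trace_bound hM
      (ε := (δ / 2) ^ 2 / (C + 1)) (by positivity)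
    let V := Submodule.span ℂ (s : Set H)
    refine ⟨T ∘L V.subtypeL ∘L V.orthogonalProjectionOnto, ?_, ?_⟩
    · exact ((isCompactOperator_of_locallyCompactSpace_rng
        (T ∘L V.subtypeL)).comp_clm V.orthogonalProjectionOnto)
    · rw [dist_eq_norm]
      refine lt_of_le_of_lt (ContinuousLinearMap.opNorm_le_bound _ (by positivity : 0 ≤ δ / 2)
        fun x => ?_) (half_lt_self hδ)
      refine (pow_le_pow_iff_left₀ (by positivity) (by positivity) two_ne_zero).1 ?_
      set y : H := x - V.starProjection x with hy
      have hyV : y ∈ Vᗮ := V.sub_starProjection_mem_orthogonal x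
      have hyx : ‖y‖ ≤ ‖x‖ := by
        rw [hy, ← V.starProjection_orthogonal_val]
        exact Vᗮ.norm_starProjection_apply_le x
      have hTy : (T - T ∘L V.subtypeL ∘L V.orthogonalProjectionOnto) x = T y := by
        rw [hy, map_sub]; rfl
      rw [hTy]
      calc ‖T y‖ ^ 2 ≤ C * (⟪T y, y⟫).re := hT y
        _ ≤ C * ((δ / 2) ^ 2 / (C + 1) * ‖y‖ ^ 2) := by gcongr; exact hs y hyV
        _ = (C / (C + 1)) * ((δ / 2) ^ 2 * ‖y‖ ^ 2) := by ring
        _ ≤ 1 * ((δ / 2) ^ 2 * ‖x‖ ^ 2) := by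
          gcongr
          exact (div_le_one (by positivity)).2 (by linarith)
        _ = _ := by ring
  exact isClosed_setOfPred_isCompactOperator.closure_subset hmem

/-- The vectors orthogonal to every eigenvector of `U`. -/
def IsOrthogonalToEigenvectors (U : H →L[ℂ] H) (x : H) : Prop :=
  ∀ (c : ℂ) (v : H), U v = c • v → ⟪v, x⟫ = 0

theorem isOrthogonalToEigenvectors_of_mem_orthogonal {U : H →L[ℂ] H} {x : H}
    (hx : x ∈ (⨆ c : ℂ, Module.End.eigenspace (U : H →ₗ[ℂ] H) c)ᗮ) :
    IsOrthogonalToEigenvectors U x := fun c v hv =>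
  hx v (Submodule.mem_iSup_of_mem c (Module.End.mem_eigenspace_iff.2 hv))

/-- A compact operator with values in a Hilbert space is approximated in norm by its compositions
with finite-rank orthogonal projections. -/
theorem exists_finset_norm_sub_starProjection_le {K : H →L[ℂ] H} (hK : IsCompactOperator K)
    {ε : ℝ} (hε : 0 < ε) :
    ∃ s : Finset H, ∀ z, ‖K z - (Submodule.span ℂ (s : Set H)).starProjection (K z)‖ ≤ ε * ‖z‖ := by
  obtain ⟨Q, hQ, hKQ⟩ := hK.image_closedBall_subset_compact (f := (K : H →ₗ[ℂ] H)) 1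
  obtain ⟨t, ht, hcov⟩ := Metric.totallyBounded_iff.1 hQ.totallyBounded ε hε
  lift t to Finset H using ht
  refine ⟨t, fun z => ?_⟩
  let V := Submodule.span ℂ (t : Set H)
  change ‖K z - V.starProjection (K z)‖ ≤ ε * ‖z‖
  have hunit : ∀ z, ‖z‖ ≤ 1 → ‖Vᗮ.starProjection (K z)‖ ≤ ε := by
    intro z hz
    obtain ⟨e, he, hze⟩ := Set.mem_iUnion₂.1
      (hcov (hKQ ⟨z, mem_closedBall_zero_iff.2 hz, rfl⟩))
    have heV : Vᗮ.starProjection e = 0 := by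
      rw [V.starProjection_orthogonal_val,
        Submodule.starProjection_eq_self_iff.2 (Submodule.subset_span he), sub_self]
    calc ‖Vᗮ.starProjection (K z)‖ = ‖Vᗮ.starProjection (K z - e)‖ := by
          rw [map_sub, heV, sub_zero]
      _ ≤ ‖K z - e‖ := Vᗮ.norm_starProjection_apply_le _
      _ ≤ ε := (mem_ball_iff_norm.1 hze).le
  rw [← V.starProjection_orthogonal_val]
  rcases eq_or_ne z 0 with rfl | hz0
  · simp
  · have hzn : 0 < ‖z‖ := norm_pos_iff.2 hz0
    have h := hunit (((‖z‖⁻¹ : ℝ) : ℂ) • z) (by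
      rw [norm_smul, Complex.norm_real, norm_inv, norm_norm, inv_mul_cancel₀ hzn.ne'])
    rw [map_smul, map_smul, norm_smul, Complex.norm_real, norm_inv, norm_norm,
      inv_mul_le_iff₀ hzn] at h
    linarith

variable [CompleteSpace H]

theorem inner_map_map_of_mem_unitary {U : H →L[ℂ] H} (hU : U ∈ unitary (H →L[ℂ] H)) (x y : H) :
    ⟪U x, U y⟫ = ⟪x, y⟫ := by
  rw [← ContinuousLinearMap.adjoint_inner_right, ← ContinuousLinearMap.star_eq_adjoint,
    ← mul_apply_eq_comp, Unitary.star_mul_self_of_mem hU,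
    one_apply_eq_self]

theorem norm_map_of_mem_unitary {U : H →L[ℂ] H} (hU : U ∈ unitary (H →L[ℂ] H)) (x : H) :
    ‖U x‖ = ‖x‖ := by
  rw [@norm_eq_sqrt_re_inner ℂ, inner_map_map_of_mem_unitary hU, ← @norm_eq_sqrt_re_inner ℂ]

/-- A nonzero compact self-adjoint operator commuting with `U` shares an eigenvector with `U`. -/
theorem exists_common_eigenvector {U T : H →L[ℂ] H} (hT : IsCompactOperator T)
    (hsymm : (T : H →ₗ[ℂ] H).IsSymmetric) (hcomm : ∀ x, T (U x) = U (T x)) (hT0 : T ≠ 0) :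
    ∃ (v : H) (c μ : ℂ), v ≠ 0 ∧ μ ≠ 0 ∧ U v = c • v ∧ T v = μ • v := by
  have hex : ∃ μ, Module.End.HasEigenvalue (T : Module.End ℂ H) μ ∧ μ ≠ 0 := by
    by_contra! h
    exact hT0 ((ContinuousLinearMap.eq_zero_of_forall_hasEigenvalue_eq_zero hT hsymm).1 h)
  obtain ⟨μ, hμ, hμ0⟩ := hex
  let E := Module.End.eigenspace (T : Module.End ℂ H) μ
  have : FiniteDimensional ℂ E := ContinuousLinearMap.finite_dimensional_eigenspace hT μ hμ0
  have : Nontrivial E := Submodule.nontrivial_iff_ne_bot.2 hμ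
  have hE : ∀ x ∈ E, (U : H →ₗ[ℂ] H) x ∈ E := by
    intro x hx
    rw [Module.End.mem_eigenspace_iff] at hx ⊢
    change T x = μ • x at hx
    change T (U x) = μ • U x
    rw [hcomm, hx, map_smul]
  obtain ⟨c, hc⟩ := Module.End.exists_eigenvalue ((U : H →ₗ[ℂ] H).restrict hE)
  obtain ⟨v, hv⟩ := hc.exists_hasEigenvector
  refine ⟨v, c, μ, fun h => hv.2 (Subtype.ext h), hμ0, congrArg Subtype.val hv.apply_eq_smul, ?_⟩
  exact Module.End.mem_eigenspace_iff.1 v.2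

theorem norm_pow_apply_of_mem_unitary {U : H →L[ℂ] H} (hU : U ∈ unitary (H →L[ℂ] H)) (x : H)
    (j : ℕ) : ‖(U ^ j) x‖ = ‖x‖ :=
  norm_map_of_mem_unitary (pow_mem hU j) x

theorem inner_pow_apply_eq_zero_of_eigenvector {U : H →L[ℂ] H} (hU : U ∈ unitary (H →L[ℂ] H))
    {ψ v : H} {c : ℂ} (hv0 : v ≠ 0) (hv : U v = c • v) (h : ⟪v, ψ⟫ = 0) (j : ℕ) :
    ⟪(U ^ j) ψ, v⟫ = 0 := by
  have hc : c ≠ 0 := by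
    rintro rfl
    have h1 := norm_map_of_mem_unitary hU v
    rw [hv, zero_smul, norm_zero] at h1
    exact hv0 (norm_eq_zero.1 h1.symm)
  induction j with
  | zero => simpa using inner_eq_zero_symm.1 h
  | succ j ih =>
    have h2 : c * ⟪(U ^ (j + 1)) ψ, v⟫ = 0 := by
      rw [← inner_smul_right, ← hv, pow_succ', mul_apply_eq_comp,
        inner_map_map_of_mem_unitary hU, ih]
    exact (mul_eq_zero.1 h2).resolve_left hc

theorem tendsto_inner_meanRankOne_map_sub {U : H →L[ℂ] H} (hU : U ∈ unitary (H →L[ℂ] H))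
    (ψ v w : H) :
    Tendsto (fun n => ⟪meanRankOne (fun j => (U ^ j) ψ) n (U v), U w⟫ -
      ⟪meanRankOne (fun j => (U ^ j) ψ) n v, w⟫) atTop (nhds 0) := by
  let g : ℕ → ℂ := fun j => ⟪U v, (U ^ j) ψ⟫ * ⟪(U ^ j) ψ, U w⟫
  have hg : ∀ j, ‖g j‖ ≤ (‖v‖ * ‖ψ‖) * (‖ψ‖ * ‖w‖) := fun j => by
    rw [norm_mul]
    refine mul_le_mul ?_ ?_ (norm_nonneg _) (by positivity)
    · simpa only [norm_pow_apply_of_mem_unitary hU, norm_map_of_mem_unitary hU] using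
        norm_inner_le_norm (𝕜 := ℂ) (U v) ((U ^ j) ψ)
    · simpa only [norm_pow_apply_of_mem_unitary hU, norm_map_of_mem_unitary hU] using
        norm_inner_le_norm (𝕜 := ℂ) ((U ^ j) ψ) (U w)
  have heq : ∀ n : ℕ, ⟪meanRankOne (fun j => (U ^ j) ψ) n (U v), U w⟫ -
      ⟪meanRankOne (fun j => (U ^ j) ψ) n v, w⟫ = (n : ℂ)⁻¹ * (g 0 - g n) := by
    intro n
    rw [inner_meanRankOne, inner_meanRankOne, ← mul_sub, ← Finset.sum_range_sub' g,
      ← Finset.sum_sub_distrib]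
    congr 1
    refine Finset.sum_congr rfl fun j _ => ?_
    simp only [g, pow_succ', mul_apply_eq_comp, inner_map_map_of_mem_unitary hU]
  simp_rw [heq]
  refine Tendsto.zero_mul_isBoundedUnder_le (tendsto_inv_atTop_nhds_zero_nat (𝕜 := ℂ)) ?_
  refine isBoundedUnder_of ⟨_, fun n => (norm_sub_le _ _).trans (add_le_add (hg 0) (hg n))⟩

/-- Wiener's theorem: along the orbit of a vector orthogonal to all eigenvectors of `U`, the
squared matrix coefficients tend to zero in mean. -/
theorem tendsto_meanSqInner_of_orthogonal_eigenvectors {U : H →L[ℂ] H}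
    (hU : U ∈ unitary (H →L[ℂ] H)) {ψ : H} (hψ : IsOrthogonalToEigenvectors U ψ) (x : H) :
    Tendsto (meanSqInner (fun j => (U ^ j) ψ) x) atTop (nhds 0) := by
  rw [tendsto_iff_ultrafilter]
  intro F hF
  set u : ℕ → H := fun j => (U ^ j) ψ
  have hu : ∀ j, ‖u j‖ = ‖ψ‖ := norm_pow_apply_of_mem_unitary hU ψ
  obtain ⟨T, hT⟩ := exists_tendsto_inner_ultrafilter F (meanRankOne u)
    (norm_inner_meanRankOne_le hu)
  have hq : ∀ v, Tendsto (meanSqInner u v) F (nhds (⟪T v, v⟫).re) := fun v => by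
    have h := (Complex.continuous_re.tendsto _).comp (hT v v)
    refine h.congr fun n => ?_
    simp [inner_meanRankOne_self]
  have hTcs : ∀ v, ‖T v‖ ^ 2 ≤ ‖ψ‖ ^ 2 * (⟪T v, v⟫).re := by
    intro v
    have h : ‖⟪T v, T v⟫‖ ^ 2 ≤ (⟪T v, v⟫).re * (‖ψ‖ ^ 2 * ‖T v‖ ^ 2) :=
      le_of_tendsto_of_tendsto ((hT v (T v)).norm.pow 2) ((hq v).mul_const _)
        (Eventually.of_forall fun n => norm_inner_meanRankOne_sq_le hu n v (T v))
    rw [inner_self_eq_norm_sq_to_K, norm_pow, RCLike.norm_ofReal, abs_norm] at h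
    rcases eq_or_ne (T v) 0 with h0 | h0
    · simp [h0]
    · have hpos : 0 < ‖T v‖ ^ 2 := by positivity
      nlinarith
  have hcompact : IsCompactOperator T :=
    isCompactOperator_of_trace_bound (by positivity) (fun s hs =>
      le_of_tendsto (tendsto_finsetSum s fun e _ => hq e)
        (Eventually.of_forall fun n => sum_meanSqInner_le hu hs n)) hTcs
  have hsymm : (T : H →ₗ[ℂ] H).IsSymmetric := by
    intro v w
    change ⟪T v, w⟫ = ⟪v, T w⟫
    rw [← inner_conj_symm v (T w)]
    refine tendsto_nhds_unique (hT v w) (((Complex.continuous_conj.tendsto _).comp (hT w v)).congr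
      fun n => ?_)
    simp [inner_meanRankOne, mul_comm]
  have hinv : ∀ v w, ⟪T (U v), U w⟫ = ⟪T v, w⟫ := fun v w =>
    sub_eq_zero.1 (tendsto_nhds_unique ((hT (U v) (U w)).sub (hT v w))
      ((tendsto_inner_meanRankOne_map_sub hU ψ v w).mono_left hF))
  have hcomm : ∀ v, T (U v) = U (T v) := by
    intro v
    refine ext_inner_right ℂ fun w => ?_
    have hw : U ((star U) w) = w := by
      rw [← mul_apply_eq_comp, Unitary.mul_star_self_of_mem hU, one_apply_eq_self]
    rw [← hw, hinv, inner_map_map_of_mem_unitary hU]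
  have hT0 : T = 0 := by
    by_contra hne
    obtain ⟨v, c, μ, hv0, hμ, hUv, hTv⟩ := exists_common_eigenvector hcompact hsymm hcomm hne
    have hz : ⟪T v, v⟫ = 0 := by
      refine tendsto_nhds_unique (hT v v) (tendsto_const_nhds.congr fun n => ?_)
      have hz' : ∀ j, ⟪u j, v⟫ = 0 :=
        inner_pow_apply_eq_zero_of_eigenvector hU hv0 hUv (hψ c v hUv)
      simp [inner_meanRankOne, hz']
    rw [hTv, inner_smul_left] at hz
    simp [hμ, hv0] at hz
  simpa [hT0] using hq x

theorem IsOrthogonalToEigenvectors.star_unitary {U : H →L[ℂ] H}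
    (hU : U ∈ unitary (H →L[ℂ] H)) {x : H} (hx : IsOrthogonalToEigenvectors U x) : IsOrthogonalToEigenvectors (star U) x := by
  intro c v hv
  have hv' : v = c • U v := by
    rw [← map_smul, ← hv, ← mul_apply_eq_comp, Unitary.mul_star_self_of_mem hU,
      one_apply_eq_self]
  rcases eq_or_ne c 0 with rfl | hc
  · rw [hv', zero_smul, inner_zero_left]
  · refine hx c⁻¹ v ?_
    conv_rhs => rw [hv', smul_smul, inv_mul_cancel₀ hc, one_smul]

theorem tendsto_mean_inner_mul_inner {U : H →L[ℂ] H} (hU : U ∈ unitary (H →L[ℂ] H)) {x y : H}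
    (hxy : IsOrthogonalToEigenvectors U x ∨ IsOrthogonalToEigenvectors U y) (v w : H) :
    Tendsto (fun n : ℕ => (n : ℂ)⁻¹ *
      ∑ j ∈ Finset.range n, ⟪v, (U ^ j) x⟫ * ⟪(U ^ j) y, w⟫) atTop (nhds 0) := by
  have hprod : Tendsto (fun n => meanSqInner (fun j => (U ^ j) x) v n *
      meanSqInner (fun j => (U ^ j) y) w n) atTop (nhds 0) := by
    have hbd : ∀ z e : H, IsBoundedUnder (· ≤ ·) atTop
        ((‖·‖) ∘ meanSqInner (fun j => (U ^ j) z) e) := fun z e =>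
      isBoundedUnder_of ⟨‖z‖ ^ 2 * ‖e‖ ^ 2, fun n => by
        rw [Function.comp_apply, Real.norm_of_nonneg (meanSqInner_nonneg _ _ _)]
        exact meanSqInner_le (norm_pow_apply_of_mem_unitary hU z) e n⟩
    rcases hxy with h | h
    · exact (tendsto_meanSqInner_of_orthogonal_eigenvectors hU h v).zero_mul_isBoundedUnder_le
        (hbd y w)
    · exact isBoundedUnder_le_mul_tendsto_zero (hbd x v)
        (tendsto_meanSqInner_of_orthogonal_eigenvectors hU h w)
  rw [tendsto_zero_iff_norm_tendsto_zero]
  have hsq := squeeze_zero (fun n => sq_nonneg _) (fun n => norm_mean_inner_mul_inner_sq_le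
    (fun j => (U ^ j) x) (fun j => (U ^ j) y) v w n) hprod
  simpa only [Real.sqrt_sq (norm_nonneg _), Real.sqrt_zero] using hsq.sqrt

/-- A RAGE-type theorem for unitary operators. -/
theorem tendsto_mean_inner_compact {U K : H →L[ℂ] H} (hU : U ∈ unitary (H →L[ℂ] H))
    (hK : IsCompactOperator K) {x y : H}
    (hxy : IsOrthogonalToEigenvectors U x ∨ IsOrthogonalToEigenvectors U y) :
    Tendsto (fun n : ℕ => (n : ℂ)⁻¹ *
      ∑ j ∈ Finset.range n, ⟪(U ^ j) x, K ((U ^ j) y)⟫) atTop (nhds 0) := by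
  rw [Metric.tendsto_nhds]
  intro δ hδ
  obtain ⟨s, hs⟩ := exists_finset_norm_sub_starProjection_le hK
    (ε := δ / 2 / (‖x‖ * ‖y‖ + 1)) (by positivity)
  let V := Submodule.span ℂ (s : Set H)
  let b := stdOrthonormalBasis ℂ V
  have hfin : Tendsto (fun n : ℕ => (n : ℂ)⁻¹ *
      ∑ j ∈ Finset.range n, ⟪(U ^ j) x, V.starProjection (K ((U ^ j) y))⟫) atTop (nhds 0) := by
    have h := tendsto_finsetSum Finset.univ fun i _ =>
      tendsto_mean_inner_mul_inner hU hxy.symm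
        (ContinuousLinearMap.adjoint K (b i : H)) (b i : H)
    rw [Finset.sum_const_zero] at h
    refine h.congr fun n => ?_
    rw [← Finset.mul_sum, Finset.sum_comm]
    congr 1
    refine Finset.sum_congr rfl fun j _ => ?_
    rw [b.starProjection_eq_sum_rankOne]
    simp [ContinuousLinearMap.adjoint_inner_left, mul_comm]
  filter_upwards [Metric.tendsto_nhds.1 hfin (δ / 2) (by positivity)] with n hn
  rw [dist_zero_right] at hn ⊢
  have hdiff : ‖(n : ℂ)⁻¹ * ∑ j ∈ Finset.range n, ⟪(U ^ j) x, K ((U ^ j) y)⟫ -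
      (n : ℂ)⁻¹ * ∑ j ∈ Finset.range n, ⟪(U ^ j) x, V.starProjection (K ((U ^ j) y))⟫‖ ≤ δ / 2 := by
    rw [← mul_sub, ← Finset.sum_sub_distrib, norm_mul, norm_inv, Complex.norm_natCast]
    refine (mul_le_mul_of_nonneg_left (norm_sum_le _ _) (by positivity)).trans
      (inv_natCast_mul_sum_le (by positivity) (fun j => ?_) n)
    rw [← inner_sub_right]
    refine (norm_inner_le_norm _ _).trans ?_
    have h := hs ((U ^ j) y)
    rw [norm_pow_apply_of_mem_unitary hU] at h ⊢
    calc _ ≤ ‖x‖ * (δ / 2 / (‖x‖ * ‖y‖ + 1) * ‖y‖) := by gcongr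
      _ = (δ / 2) * ((‖x‖ * ‖y‖) / (‖x‖ * ‖y‖ + 1)) := by ring
      _ ≤ (δ / 2) * 1 := by
        gcongr
        exact (div_le_one (by positivity)).2 (by linarith)
      _ = δ / 2 := mul_one _
  have h3 := norm_sub_norm_le ((n : ℂ)⁻¹ * ∑ j ∈ Finset.range n, ⟪(U ^ j) x, K ((U ^ j) y)⟫)
    ((n : ℂ)⁻¹ * ∑ j ∈ Finset.range n, ⟪(U ^ j) x, V.starProjection (K ((U ^ j) y))⟫)
  linarith

theorem exists_apply_eq_of_commutator {A : H →ₗ.[ℂ] H}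
    (hdense : Dense (A.domain : Set H)) (hsa : A.adjoint = A) {U B₀ : H →L[ℂ] H}
    (hC1 : ∀ φ ψ : A.domain,
      ⟪A φ, U (ψ : H)⟫ - ⟪(φ : H), U (A ψ)⟫ = ⟪(φ : H), B₀ (ψ : H)⟫) (ψ : A.domain) :
    ∃ h : U ψ ∈ A.domain, A ⟨U ψ, h⟩ = U (A ψ) + B₀ ψ := by
  have hkey : ∀ x : A.domain, ⟪U (A ψ) + B₀ ψ, (x : H)⟫ = ⟪U ψ, A x⟫ := by
    intro x
    rw [← inner_conj_symm, ← inner_conj_symm (U ψ) (A x), inner_add_right, ← hC1 x ψ]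
    congr 1
    ring
  have hmem : U ψ ∈ A.adjoint.domain := A.mem_adjoint_domain_of_exists _ ⟨_, hkey⟩
  have hval := LinearPMap.adjoint_apply_eq hdense ⟨U ψ, hmem⟩ hkey
  have hgraph : (U ψ, U (A ψ) + B₀ ψ) ∈ A.graph := by
    have h : (U ψ, U (A ψ) + B₀ ψ) ∈ A.adjoint.graph :=
      (LinearPMap.mem_graph_iff _).2 ⟨⟨U ψ, hmem⟩, rfl, hval⟩
    rwa [hsa] at h
  obtain ⟨z, hz1, hz2⟩ := (LinearPMap.mem_graph_iff A).1 hgraph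
  obtain ⟨z, hz⟩ := z
  obtain rfl : z = U ψ := hz1
  exact ⟨hz, hz2⟩

theorem exists_pow_apply_eq {A : H →ₗ.[ℂ] H} {U D : H →L[ℂ] H}
    (hU : U ∈ unitary (H →L[ℂ] H))
    (hA : ∀ x : A.domain, ∃ h : U x ∈ A.domain, A ⟨U x, h⟩ = U (A x + D x)) (n : ℕ)
    (x : A.domain) :
    ∃ h : (U ^ n) x ∈ A.domain, A ⟨(U ^ n) x, h⟩ =
      (U ^ n) (A x + ∑ j ∈ Finset.range n, (star U ^ j) (D ((U ^ j) x))) := by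
  induction n with
  | zero => exact ⟨by simp, by simp⟩
  | succ n ih =>
    obtain ⟨h, hn⟩ := ih
    obtain ⟨h', hn'⟩ := hA ⟨(U ^ n) x, h⟩
    have hpow : (U ^ (n + 1)) (x : H) = U ((U ^ n) x) := by rw [pow_succ', mul_apply_eq_comp]
    have hstar : ∀ z, (U ^ n) ((star U ^ n) z) = z := fun z => by
      rw [← star_pow, ← mul_apply_eq_comp, Unitary.mul_star_self_of_mem (pow_mem hU n),
        one_apply_eq_self]
    simp only [hpow]
    refine ⟨h', hn'.trans ?_⟩
    rw [hn, Finset.sum_range_succ, pow_succ', mul_apply_eq_comp, ← add_assoc,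
      map_add (U ^ n) (_ + _), hstar]

theorem tendsto_inv_mul_inner_pow {A : H →ₗ.[ℂ] H} {U B K : H →L[ℂ] H}
    (hU : U ∈ unitary (H →L[ℂ] H))
    (hA : ∀ x : A.domain, ∃ h : U x ∈ A.domain, A ⟨U x, h⟩ = U (A x + (B + K) x))
    (hBU : Commute B U) (hK : IsCompactOperator K)
    (hm : ∀ (n : ℕ) (x : A.domain), (U ^ n) (x : H) ∈ A.domain)
    (φ : H) (ψ : A.domain)
    (h : IsOrthogonalToEigenvectors U φ ∨ IsOrthogonalToEigenvectors U ψ) :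
    Tendsto (fun n : ℕ => (n : ℂ)⁻¹ * ⟪(U ^ n) φ, A ⟨(U ^ n) (ψ : H), hm n ψ⟩⟫)
      atTop (nhds ⟪φ, B ψ⟫) := by
  have hterm : ∀ j, ⟪φ, (star U ^ j) ((B + K) ((U ^ j) ψ))⟫ =
      ⟪φ, B ψ⟫ + ⟪(U ^ j) φ, K ((U ^ j) ψ)⟫ := by
    intro j
    have hB : B ((U ^ j) ψ) = (U ^ j) (B ψ) := by
      rw [← mul_apply_eq_comp, (hBU.pow_right j).eq, mul_apply_eq_comp]
    rw [← star_pow, ContinuousLinearMap.star_eq_adjoint, ContinuousLinearMap.adjoint_inner_right,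
      add_apply, inner_add_right, hB, inner_map_map_of_mem_unitary (pow_mem hU j)]
  have heq : ∀ n : ℕ, 0 < n → (n : ℂ)⁻¹ * ⟪φ, A ψ⟫ + ⟪φ, B ψ⟫ +
      (n : ℂ)⁻¹ * ∑ j ∈ Finset.range n, ⟪(U ^ j) φ, K ((U ^ j) ψ)⟫ =
      (n : ℂ)⁻¹ * ⟪(U ^ n) φ, A ⟨(U ^ n) (ψ : H), hm n ψ⟩⟫ := by
    intro n hn
    obtain ⟨_, hpow⟩ := exists_pow_apply_eq hU hA n ψ
    have hn0 : (n : ℂ) ≠ 0 := by exact_mod_cast hn.ne'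
    rw [hpow, inner_map_map_of_mem_unitary (pow_mem hU n), inner_add_right, inner_sum]
    simp_rw [hterm]
    rw [Finset.sum_add_distrib, Finset.sum_const, Finset.card_range, nsmul_eq_mul]
    field_simp
    ring
  have hlim := (((tendsto_inv_atTop_nhds_zero_nat (𝕜 := ℂ)).mul_const ⟪φ, A ψ⟫).add_const
    ⟪φ, B ψ⟫).add (tendsto_mean_inner_compact hU hK h)
  rw [zero_mul, zero_add, add_zero] at hlim
  refine hlim.congr' ?_
  filter_upwards [eventually_gt_atTop 0] with n hn using heq n hn

end Helpers

/-- Lemma 5.6 ("pp2c0"): let `U` be unitary and of class `C¹(A)` with commutator `B₀`,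
such that `(U*AU − A)° = U*B₀ = B + K` with `B` bounded commuting with `U` and `K`
compact. If `φ ∈ H`, `ψ ∈ D(A)` and at least one of them lies in the continuous subspace
`H_c(U)`, then `n⁻¹⟨U^n φ, A U^n ψ⟩ → ⟨φ, Bψ⟩` and `n⁻¹⟨U^{*n} φ, A U^{*n} ψ⟩ → −⟨φ, Bψ⟩`
as `n → ∞`. -/
theorem stmt18
    {H : Type*} [NormedAddCommGroup H] [InnerProductSpace ℂ H] [CompleteSpace H]
    -- A self-adjoint (densely defined) operator on H
    (A : H →ₗ.[ℂ] H) (hdense : Dense (A.domain : Set H)) (hsa : A.adjoint = A)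
    -- U unitary of class C¹(A) with commutator B₀
    (U B₀ : H →L[ℂ] H) (hU : U ∈ unitary (H →L[ℂ] H))
    (hC1 : ∀ φ ψ : A.domain,
      ⟪A φ, U (ψ : H)⟫ - ⟪(φ : H), U (A ψ)⟫ = ⟪(φ : H), B₀ (ψ : H)⟫)
    -- U*B₀ = B + K with B commuting with U and K compact
    (B K : H →L[ℂ] H) (hsplit : star U * B₀ = B + K)
    (hBU : B * U = U * B) (hK : IsCompactOperator ⇑K) :
    ∃ hm : ∀ (n : ℕ) (x : H), x ∈ A.domain →
        ((U ^ n) x ∈ A.domain ∧ ((star U) ^ n) x ∈ A.domain),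
      ∀ (φ : H) (ψ : A.domain),
        -- at least one of φ, ψ lies in H_c(U), the orthogonal complement of the closed
        -- span of the eigenvectors of U
        (φ ∈ (⨆ c : ℂ, Module.End.eigenspace (U : H →ₗ[ℂ] H) c)ᗮ ∨
          (ψ : H) ∈ (⨆ c : ℂ, Module.End.eigenspace (U : H →ₗ[ℂ] H) c)ᗮ) →
        Tendsto
            (fun n : ℕ => (n : ℂ)⁻¹ *
              ⟪(U ^ n) φ, A ⟨(U ^ n) (ψ : H), (hm n ψ ψ.2).1⟩⟫)
            atTop (nhds ⟪φ, B (ψ : H)⟫) ∧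
        Tendsto
            (fun n : ℕ => (n : ℂ)⁻¹ *
              ⟪((star U) ^ n) φ, A ⟨((star U) ^ n) (ψ : H), (hm n ψ ψ.2).2⟩⟫)
            atTop (nhds (-⟪φ, B (ψ : H)⟫)) := by
  have hUs : star U ∈ unitary (H →L[ℂ] H) := Unitary.star_mem hU
  have hUUs : ∀ z, U (star U z) = z := fun z => by
    rw [← mul_apply_eq_comp, Unitary.mul_star_self_of_mem hU, one_apply_eq_self]
  have hUsU : ∀ z, star U (U z) = z := fun z => by
    rw [← mul_apply_eq_comp, Unitary.star_mul_self_of_mem hU, one_apply_eq_self]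
  have hB₀ : ∀ z, B₀ z = U ((B + K) z) := fun z => by
    rw [← hsplit, mul_apply_eq_comp, hUUs]
  have hAU : ∀ x : A.domain, ∃ h : U x ∈ A.domain, A ⟨U x, h⟩ = U (A x + (B + K) x) := by
    intro x
    obtain ⟨h, hx⟩ := exists_apply_eq_of_commutator hdense hsa hC1 x
    exact ⟨h, by rw [hx, hB₀, map_add U]⟩
  have hCs : ∀ φ ψ : A.domain, ⟪A φ, star U (ψ : H)⟫ - ⟪(φ : H), star U (A ψ)⟫ =
      ⟪(φ : H), (-star B₀) (ψ : H)⟫ := by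
    intro φ ψ
    have h := congrArg (starRingEnd ℂ) (hC1 ψ φ)
    simp only [map_sub, inner_conj_symm] at h
    simp only [neg_apply, inner_neg_right, ContinuousLinearMap.star_eq_adjoint,
      ContinuousLinearMap.adjoint_inner_right]
    rw [← h]
    ring
  have hcommS : Commute (-B) (star U) := by
    have hBU' : ∀ z, B (U z) = U (B z) := fun z => by
      rw [← mul_apply_eq_comp, hBU, mul_apply_eq_comp]
    refine Commute.neg_left ?_
    ext z
    change B (star U z) = star U (B z)
    rw [← hUsU (B (star U z)), ← hBU', hUUs]
  have hAUs : ∀ x : A.domain, ∃ h : star U x ∈ A.domain,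
      A ⟨star U x, h⟩ = star U (A x + (-B + -(U * K * star U)) x) := by
    intro x
    obtain ⟨h, -⟩ := exists_apply_eq_of_commutator hdense hsa hCs x
    obtain ⟨h', hx⟩ := hAU ⟨star U x, h⟩
    refine ⟨h, ?_⟩
    simp only [hUUs] at hx
    change A x = _ at hx
    have hB : U (B (star U (x : H))) = B x := by
      rw [← mul_apply_eq_comp U B, ← hBU, mul_apply_eq_comp, hUUs]
    rw [hx]
    simp only [map_add, add_apply, neg_apply, mul_apply_eq_comp, map_neg, hB, hUsU]
    abel
  have hKs : IsCompactOperator (-(U * K * star U) : H →L[ℂ] H) :=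
    ((hK.clm_comp U).comp_clm (star U)).neg
  have hm : ∀ (n : ℕ) (x : H), x ∈ A.domain →
      ((U ^ n) x ∈ A.domain ∧ ((star U) ^ n) x ∈ A.domain) := fun n x hx =>
    ⟨(exists_pow_apply_eq hU hAU n ⟨x, hx⟩).1,
      (exists_pow_apply_eq hUs hAUs n ⟨x, hx⟩).1⟩
  refine ⟨hm, fun φ ψ h => ?_⟩
  have horth : IsOrthogonalToEigenvectors U φ ∨ IsOrthogonalToEigenvectors U (ψ : H) :=
    h.imp isOrthogonalToEigenvectors_of_mem_orthogonal isOrthogonalToEigenvectors_of_mem_orthogonal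
  refine ⟨tendsto_inv_mul_inner_pow hU hAU hBU hK (fun n x => (hm n x x.2).1) φ ψ horth,
    ?_⟩
  have hlim := tendsto_inv_mul_inner_pow hUs hAUs hcommS hKs
    (fun n x => (hm n x x.2).2) φ ψ (horth.imp (·.star_unitary hU) (·.star_unitary hU))
  rwa [neg_apply, inner_neg_right] at hlim
end

section
/- Let d ∈ ℕ, α ∈ ℤ^d \ {0}, |α|² = Σ_j α_j², and let A be the self-adjoint operator on ℓ²(ℤ^d) of multiplication by α·β (A e_β = (Σ_j α_jβ_j)e_β) with its maximal domain. Let U be a unitary operator on ℓ²(ℤ^d) such that: (1) U is of class C¹(X_j) for each j (so U and U* preserve D_X); (2) U is of class C¹(A) with commutator B_U; (3) T^{−α}U is of class C¹(X_j²) for each j, where X_j² is the self-adjoint diagonal operator e_β ↦ β_j² e_β with its maximal domain; and (4) the bounded operator T^{−α}B_U − |α|²·T^{−α}U (which equals ad_A(T^{−α}U)) is compact. Then for every ψ ∈ H_c(U) ∩ D_X: lim_{n→∞} n^{−1}·‖U^nψ‖_X = √(|α|²)·‖ψ‖ and lim_{n→∞} n^{−1}·‖U^{*n}ψ‖_X =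 √(|α|²)·‖ψ‖. -/
open scoped ComplexInnerProductSpace
open Filter

noncomputable section

/-- `ℓ²(ℤ^d)`. -/
abbrev l2Zd (d : ℕ) : Type := lp (fun _ : (Fin d → ℤ) => ℂ) 2

/-- Membership in `D_X = ∩_j D(X_j)`: each `X_j φ = (β ↦ β_j φ(β))` is square-summable. -/
def memDX {d : ℕ} (φ : l2Zd d) : Prop :=
  ∀ j : Fin d, Memℓp (fun β : Fin d → ℤ => ((β j : ℤ) : ℂ) * φ β) 2

/-- `‖φ‖_X² = ‖φ‖² + Σ_j ‖X_j φ‖²` (written via `tsum`s). -/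
noncomputable def xNormSq {d : ℕ} (φ : l2Zd d) : ℝ :=
  ‖φ‖ ^ 2 + ∑ j : Fin d, ∑' β : Fin d → ℤ, (β j : ℝ) ^ 2 * ‖φ β‖ ^ 2

section RealSequences

open Topology

theorem tendsto_div_sq_of_recurrence {p q e : ℕ → ℝ} {c M : ℝ}
    (he : Tendsto (fun n : ℕ => (n : ℝ)⁻¹ * ∑ k ∈ Finset.range n, e k) atTop (𝓝 0))
    (hp : ∀ k, |p (k + 1) - p k - c| ≤ e k)
    (hq : ∀ k, |q (k + 1) - q k - 2 * p k| ≤ M) :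
    Tendsto (fun n : ℕ => ((n : ℝ) ^ 2)⁻¹ * q n) atTop (𝓝 c) := by
  have he0 : ∀ k, 0 ≤ e k := fun k => (abs_nonneg _).trans (hp k)
  have hpn : ∀ n : ℕ, |p n - n * c| ≤ |p 0| + ∑ k ∈ Finset.range n, e k := by
    intro n
    induction n with
    | zero => simp
    | succ n ih =>
      rw [Finset.sum_range_succ]
      have h1 := hp n
      rw [abs_le] at h1 ih ⊢
      push_cast
      constructor <;> linarith [h1.1, h1.2, ih.1, ih.2]
  have hqn : ∀ n : ℕ, |q n - (n : ℝ) ^ 2 * c| ≤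
      |q 0| + n * (M + 2 * |p 0| + |c|) + 2 * n * ∑ k ∈ Finset.range n, e k := by
    intro n
    induction n with
    | zero => simp
    | succ n ih =>
      rw [Finset.sum_range_succ]
      have h1 := hq n
      have h2 := hpn n
      have h3 := he0 n
      have h4 : 0 ≤ (n : ℝ) * e n := by positivity
      have h5 := Finset.sum_nonneg fun k (_ : k ∈ Finset.range n) => he0 k
      have h6 := neg_abs_le c
      have h7 := le_abs_self c
      rw [abs_le] at h1 h2 ih ⊢
      push_cast
      constructor <;> nlinarith [h1.1, h1.2, h2.1, h2.2, ih.1, ih.2]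
  rw [tendsto_iff_norm_sub_tendsto_zero]
  have hlim : Tendsto (fun n : ℕ => (n : ℝ)⁻¹ * ((n : ℝ)⁻¹ * |q 0|) +
      (n : ℝ)⁻¹ * (M + 2 * |p 0| + |c|) + 2 * ((n : ℝ)⁻¹ * ∑ k ∈ Finset.range n, e k))
      atTop (𝓝 0) := by
    have hi := tendsto_inv_atTop_nhds_zero_nat (𝕜 := ℝ)
    simpa using ((hi.mul (hi.mul_const |q 0|)).add
      (hi.mul_const (M + 2 * |p 0| + |c|))).add (he.const_mul 2)
  refine squeeze_zero' (Eventually.of_forall fun n => norm_nonneg _) ?_ hlim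
  filter_upwards [eventually_gt_atTop 0] with n hn
  have hn' : (0 : ℝ) < n := Nat.cast_pos.2 hn
  calc ‖((n : ℝ) ^ 2)⁻¹ * q n - c‖ = ((n : ℝ) ^ 2)⁻¹ * |q n - (n : ℝ) ^ 2 * c| := by
        rw [Real.norm_eq_abs, ← abs_of_pos (inv_pos.2 (pow_pos hn' 2)), ← abs_mul,
          abs_of_pos (inv_pos.2 (pow_pos hn' 2))]
        congr 1
        field_simp
    _ ≤ ((n : ℝ) ^ 2)⁻¹ * (|q 0| + n * (M + 2 * |p 0| + |c|) +
          2 * n * ∑ k ∈ Finset.range n, e k) := by gcongr; exact hqn n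
    _ = _ := by field_simp

theorem tendsto_inv_mul_sqrt_of_recurrence {p q e : ℕ → ℝ} {c M s : ℝ}
    (he : Tendsto (fun n : ℕ => (n : ℝ)⁻¹ * ∑ k ∈ Finset.range n, e k) atTop (𝓝 0))
    (hp : ∀ k, |p (k + 1) - p k - c| ≤ e k)
    (hq : ∀ k, |q (k + 1) - q k - 2 * p k| ≤ M) :
    Tendsto (fun n : ℕ => (n : ℝ)⁻¹ * √(s + q n)) atTop (𝓝 √c) := by
  have h := tendsto_div_sq_of_recurrence (q := fun n => s + q n) he hp
    (fun k => by simpa [add_sub_add_left_eq_sub] using hq k)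
  refine ((Real.continuous_sqrt.tendsto c).comp h).congr fun n => ?_
  simp only [Function.comp]
  rw [Real.sqrt_mul (by positivity), Real.sqrt_inv, Real.sqrt_sq n.cast_nonneg]

end RealSequences

section RAGE

open Topology
open scoped TensorProduct

variable {ι : Type*}

local notation "ℋ" => lp (fun _ : ι => ℂ) 2

theorem lp.inner_star_star (x y : ℋ) : ⟪star x, star y⟫ = ⟪y, x⟫ := by
  simp [lp.inner_eq_tsum, mul_comm]

/-- The conjugate `x ↦ star (V (star x))` of a linear isometry of `ℓ²`. -/
def lp.conjIsometry (V : ℋ →ₗᵢ[ℂ] ℋ) : ℋ →ₗᵢ[ℂ] ℋ where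
  toFun x := star (V (star x))
  map_add' x y := by simp
  map_smul' c x := by simp [star_smul]
  norm_map' x := by simp

/-- The identification of tensors `x ⊗ star y` with rank-one operators `|x⟩⟨y|`. -/
def lp.tensorToOp : ℋ ⊗[ℂ] ℋ →ₗ[ℂ] (ℋ →L[ℂ] ℋ) :=
  TensorProduct.lift <| LinearMap.mk₂ ℂ (fun x y => InnerProductSpace.rankOne ℂ x (star y))
    (by intros; simp) (by intros; simp) (by intros; simp [star_add])
    (by intros; simp [star_smul])

theorem lp.tensorToOp_tmul (x y : ℋ) :
    lp.tensorToOp (x ⊗ₜ[ℂ] y) = InnerProductSpace.rankOne ℂ x (star y) := rfl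

theorem lp.inner_tensorToOp_apply (e : ℋ ⊗[ℂ] ℋ) (φ χ : ℋ) :
    ⟪φ, lp.tensorToOp e χ⟫ = ⟪φ ⊗ₜ[ℂ] star χ, e⟫ := by
  induction e with
  | zero => simp
  | tmul x y =>
    have : ⟪star y, χ⟫ = ⟪star χ, y⟫ := by
      conv_rhs => rw [← star_star y, lp.inner_star_star]
    simp [lp.tensorToOp_tmul, this, mul_comm]
  | add x y hx hy => simp [hx, hy, inner_add_right]

theorem lp.norm_tensorToOp_le (e : ℋ ⊗[ℂ] ℋ) : ‖lp.tensorToOp e‖ ≤ 1 * ‖e‖ := by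
  rw [one_mul]
  refine ContinuousLinearMap.opNorm_le_bound _ (norm_nonneg _) fun χ => ?_
  rcases eq_or_ne (lp.tensorToOp e χ) 0 with h | h
  · rw [h, norm_zero]; positivity
  · have h1 : ‖lp.tensorToOp e χ‖ * ‖lp.tensorToOp e χ‖ ≤
        ‖lp.tensorToOp e χ‖ * (‖e‖ * ‖χ‖) := by
      calc _ = ‖⟪lp.tensorToOp e χ, lp.tensorToOp e χ⟫‖ := by
            rw [inner_self_eq_norm_sq_to_K (𝕜 := ℂ)]; simp [sq]
        _ ≤ _ := by
            rw [lp.inner_tensorToOp_apply]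
            refine (norm_inner_le_norm (𝕜 := ℂ) (lp.tensorToOp e χ ⊗ₜ[ℂ] star χ) e).trans_eq ?_
            rw [TensorProduct.norm_tmul, norm_star]
            ring
    exact le_of_mul_le_mul_left h1 (norm_pos_iff.2 h)

/-- The continuous extension of `lp.tensorToOp` to the Hilbert space tensor product. -/
def lp.complTensorToOp : UniformSpace.Completion (ℋ ⊗[ℂ] ℋ) →L[ℂ] (ℋ →L[ℂ] ℋ) :=
  (lp.tensorToOp.mkContinuous 1 lp.norm_tensorToOp_le).fromCompletion

theorem lp.complTensorToOp_coe (e : ℋ ⊗[ℂ] ℋ) :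
    lp.complTensorToOp (e : UniformSpace.Completion (ℋ ⊗[ℂ] ℋ)) = lp.tensorToOp e := by
  simp [lp.complTensorToOp]

/-- The tensor product of `V` and its conjugate, an isometry on the Hilbert space tensor product `ℓ² ⊗ ℓ²`. -/
def lp.complTensorConj (V : ℋ →ₗᵢ[ℂ] ℋ) :
    UniformSpace.Completion (ℋ ⊗[ℂ] ℋ) →L[ℂ] UniformSpace.Completion (ℋ ⊗[ℂ] ℋ) :=
  (TensorProduct.mapIsometry V (lp.conjIsometry V)).toContinuousLinearMap.completion

theorem lp.complTensorConj_tmul (V : ℋ →ₗᵢ[ℂ] ℋ) (x y : ℋ) :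
    lp.complTensorConj V (x ⊗ₜ[ℂ] star y : ℋ ⊗[ℂ] ℋ) = (V x ⊗ₜ[ℂ] star (V y) : ℋ ⊗[ℂ] ℋ) := by
  simp [lp.complTensorConj, lp.conjIsometry]

theorem lp.norm_complTensorConj_le (V : ℋ →ₗᵢ[ℂ] ℋ) : ‖lp.complTensorConj V‖ ≤ 1 := by
  refine ContinuousLinearMap.opNorm_le_bound _ zero_le_one fun e => ?_
  rw [one_mul]
  induction e using UniformSpace.Completion.induction_on with
  | hp => exact isClosed_le (by fun_prop) (by fun_prop)
  | ih e =>
    rw [lp.complTensorConj, ContinuousLinearMap.completion_apply_coe]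
    simp

theorem lp.complTensorToOp_complTensorConj (V : ℋ →ₗᵢ[ℂ] ℋ)
    (e : UniformSpace.Completion (ℋ ⊗[ℂ] ℋ)) (χ : ℋ) :
    lp.complTensorToOp (lp.complTensorConj V e) (V χ) = V (lp.complTensorToOp e χ) := by
  induction e using UniformSpace.Completion.induction_on with
  | hp => exact isClosed_eq (by fun_prop) (by fun_prop)
  | ih e =>
    induction e with
    | zero => simp [UniformSpace.Completion.coe_zero]
    | tmul x y =>
      rw [← star_star y, lp.complTensorConj_tmul, lp.complTensorToOp_coe, lp.complTensorToOp_coe]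
      simp [lp.tensorToOp_tmul]
    | add x y hx hy => simp [UniformSpace.Completion.coe_add, hx, hy]

theorem ContinuousLinearMap.exists_isFixedPt_tendsto_birkhoffAverage {E : Type*}
    [NormedAddCommGroup E] [InnerProductSpace ℂ E] [CompleteSpace E] (f : E →L[ℂ] E)
    (hf : ‖f‖ ≤ 1) (x : E) :
    ∃ e, f e = e ∧ Tendsto (birkhoffAverage ℂ f _root_.id · x) atTop (𝓝 e) := by
  refine ⟨_, ?_, f.tendsto_birkhoffAverage_orthogonalProjection hf x⟩
  exact (LinearMap.mem_eqLocus (f := (f : E →ₗ[ℂ] E))).1 (Subtype.prop _)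

theorem LinearIsometry.map_mem_orthogonal_iSup_eigenspace {E : Type*} [NormedAddCommGroup E]
    [InnerProductSpace ℂ E] (V : E →ₗᵢ[ℂ] E) {ψ : E}
    (hψ : ψ ∈ (⨆ c : ℂ, Module.End.eigenspace V.toLinearMap c)ᗮ) :
    V ψ ∈ (⨆ c : ℂ, Module.End.eigenspace V.toLinearMap c)ᗮ := by
  rw [← Submodule.iInf_orthogonal, Submodule.mem_iInf] at hψ ⊢
  intro c
  rw [Submodule.mem_orthogonal]
  intro v hv
  have h0 : ⟪v, ψ⟫ = 0 := (Submodule.mem_orthogonal _ _).1 (hψ c) v hv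
  have hv' : V v = c • v := Module.End.mem_eigenspace_iff.1 hv
  rw [← V.inner_map_map, hv', inner_smul_left] at h0
  rcases mul_eq_zero.1 h0 with h | h
  · have : v = 0 := by
      rw [← norm_eq_zero, ← V.norm_map, hv', (map_eq_zero _).1 h]; simp
    simp [this]
  · exact h

theorem LinearIsometry.eq_zero_of_isCompactOperator_of_commute {E : Type*} [NormedAddCommGroup E]
    [InnerProductSpace ℂ E] [CompleteSpace E] (V : E →ₗᵢ[ℂ] E) (S : E →L[ℂ] E)
    (hc : IsCompactOperator S) (hs : S.IsSymmetric) (hVS : ∀ x, S (V x) = V (S x))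
    (hr : ∀ x, S x ∈ (⨆ c : ℂ, Module.End.eigenspace V.toLinearMap c)ᗮ) : S = 0 := by
  rw [← ContinuousLinearMap.eq_zero_of_forall_hasEigenvalue_eq_zero hc hs]
  intro μ hμ
  by_contra h0
  have := ContinuousLinearMap.finite_dimensional_eigenspace hc μ h0
  have hinv : ∀ x ∈ Module.End.eigenspace S.toLinearMap μ,
      V.toLinearMap x ∈ Module.End.eigenspace S.toLinearMap μ := by
    intro x hx
    rw [Module.End.mem_eigenspace_iff] at hx ⊢
    have hx' : S x = μ • x := hx
    simp [hVS, hx']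
  have : Nontrivial (Module.End.eigenspace S.toLinearMap μ) :=
    Submodule.nontrivial_iff_ne_bot.2 hμ
  obtain ⟨c, hc⟩ := Module.End.exists_eigenvalue (V.toLinearMap.restrict hinv)
  obtain ⟨v, hv⟩ := hc.exists_hasEigenvector
  have hVv : V v = c • (v : E) := congrArg Subtype.val hv.apply_eq_smul
  have hSv : S v = μ • (v : E) := Module.End.mem_eigenspace_iff.1 v.2
  have hmem : (v : E) ∈ (⨆ c : ℂ, Module.End.eigenspace V.toLinearMap c)ᗮ := by
    have : (v : E) = μ⁻¹ • S v := by rw [hSv, smul_smul, inv_mul_cancel₀ h0, one_smul]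
    rw [this]
    exact Submodule.smul_mem _ _ (hr _)
  have hmem' : (v : E) ∈ ⨆ c : ℂ, Module.End.eigenspace V.toLinearMap c :=
    Submodule.mem_iSup_of_mem c (Module.End.mem_eigenspace_iff.2 hVv)
  have : (v : E) = 0 := inner_self_eq_zero.1 ((Submodule.mem_orthogonal _ _).1 hmem _ hmem')
  exact hv.2 (Subtype.ext this)

/-- **Wiener lemma**: the matrix elements along the orbit of a vector orthogonal to all
eigenvectors of an isometry tend to zero in quadratic mean. -/
theorem lp.tendsto_cesaro_norm_inner_sq (V : ℋ →ₗᵢ[ℂ] ℋ) {ψ : ℋ}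
    (hψ : ψ ∈ (⨆ c : ℂ, Module.End.eigenspace V.toLinearMap c)ᗮ) (φ : ℋ) :
    Tendsto (fun n : ℕ => (n : ℝ)⁻¹ * ∑ k ∈ Finset.range n, ‖⟪φ, V^[k] ψ⟫‖ ^ 2)
      atTop (𝓝 0) := by
  set M := (⨆ c : ℂ, Module.End.eigenspace V.toLinearMap c)ᗮ
  have hmem : ∀ k, V^[k] ψ ∈ M := by
    intro k
    induction k with
    | zero => exact hψ
    | succ k ih =>
      rw [Function.iterate_succ_apply']
      exact V.map_mem_orthogonal_iSup_eigenspace ih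
  set f := lp.complTensorConj V
  set x : UniformSpace.Completion (ℋ ⊗[ℂ] ℋ) := ↑(ψ ⊗ₜ[ℂ] star ψ : ℋ ⊗[ℂ] ℋ)
  have hit : ∀ k, f^[k] x = ↑(V^[k] ψ ⊗ₜ[ℂ] star (V^[k] ψ) : ℋ ⊗[ℂ] ℋ) := by
    intro k
    induction k with
    | zero => rfl
    | succ k ih =>
      rw [Function.iterate_succ_apply', Function.iterate_succ_apply', ih]
      exact lp.complTensorConj_tmul V _ _
  obtain ⟨e, hfe, he⟩ : ∃ e, f e = e ∧ Tendsto (birkhoffAverage ℂ f _root_.id · x) atTop (𝓝 e) :=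
    f.exists_isFixedPt_tendsto_birkhoffAverage (lp.norm_complTensorConj_le V) x
  let S := lp.complTensorToOp e
  let A : ℕ → (ℋ →L[ℂ] ℋ) := fun n => (n : ℂ)⁻¹ • ∑ k ∈ Finset.range n,
    InnerProductSpace.rankOne ℂ (V^[k] ψ) (V^[k] ψ)
  have hA : Tendsto A atTop (𝓝 S) := by
    have h1 := (lp.complTensorToOp.continuous.tendsto e).comp he
    refine h1.congr fun n => ?_
    simp [birkhoffAverage, birkhoffSum, A, hit, lp.complTensorToOp_coe, lp.tensorToOp_tmul]
  have hAx : ∀ χ, Tendsto (fun n => A n χ) atTop (𝓝 (S χ)) := fun χ =>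
    ((ContinuousLinearMap.apply ℂ ℋ χ).continuous.tendsto S).comp hA
  have hS0 : S = 0 := by
    apply V.eq_zero_of_isCompactOperator_of_commute S
    · refine isCompactOperator_of_tendsto hA (Eventually.of_forall fun n => ?_)
      refine (compactOperator (RingHom.id ℂ) ℋ ℋ).smul_mem _
        (Submodule.sum_mem _ fun k _ => ?_)
      exact (isCompactOperator_of_locallyCompactSpace_dom
        (innerSL ℂ (V^[k] ψ))).clm_comp (ContinuousLinearMap.toSpanSingleton ℂ (V^[k] ψ))
    · intro χ η
      refine tendsto_nhds_unique ((hAx χ).inner tendsto_const_nhds) ?_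
      refine (tendsto_const_nhds.inner (hAx η)).congr fun n => ?_
      simp [A, inner_smul_left, inner_smul_right, sum_inner, inner_sum, mul_comm]
    · intro χ
      have := lp.complTensorToOp_complTensorConj V e χ
      change lp.complTensorToOp (f e) (V χ) = _ at this
      rwa [hfe] at this
    · intro χ
      refine (Submodule.isClosed_orthogonal _).mem_of_tendsto (hAx χ)
        (Eventually.of_forall fun n => ?_)
      simp only [A, _root_.smul_apply, _root_.sum_apply,
        InnerProductSpace.rankOne_apply]
      exact M.smul_mem _ (M.sum_mem fun k _ => M.smul_mem _ (hmem k))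
  have h := (tendsto_const_nhds (x := φ)).inner (𝕜 := ℂ) (hAx φ)
  rw [hS0] at h
  have h2 := (Complex.continuous_re.tendsto _).comp h
  simp only [_root_.zero_apply, inner_zero_right, Complex.zero_re] at h2
  refine h2.congr fun n => ?_
  have : ∀ k, ⟪V^[k] ψ, φ⟫ * ⟪φ, V^[k] ψ⟫ = ((‖⟪φ, V^[k] ψ⟫‖ ^ 2 : ℝ) : ℂ) := by
    intro k
    rw [← inner_conj_symm, ← Complex.normSq_eq_conj_mul_self, Complex.normSq_eq_norm_sq]
  simp only [A, Function.comp, _root_.smul_apply, _root_.sum_apply,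
    InnerProductSpace.rankOne_apply, inner_smul_right, inner_sum, this]
  rw [← Complex.ofReal_sum, ← Complex.ofReal_natCast, ← Complex.ofReal_inv, ← Complex.ofReal_mul,
    Complex.ofReal_re]

theorem tendsto_cesaro_of_sq {a : ℕ → ℝ}
    (ha : Tendsto (fun n : ℕ => (n : ℝ)⁻¹ * ∑ k ∈ Finset.range n, a k ^ 2) atTop (𝓝 0)) :
    Tendsto (fun n : ℕ => (n : ℝ)⁻¹ * ∑ k ∈ Finset.range n, a k) atTop (𝓝 0) := by
  have h := (Real.continuous_sqrt.tendsto 0).comp ha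
  rw [Real.sqrt_zero] at h
  refine squeeze_zero_norm (fun n => Real.le_sqrt_of_sq_le ?_) h
  rcases Nat.eq_zero_or_pos n with rfl | hn
  · simp
  have hn' : (0 : ℝ) < n := Nat.cast_pos.2 hn
  have h1 := sq_sum_le_card_mul_sum_sq (s := Finset.range n) (f := a)
  rw [Finset.card_range] at h1
  rw [Real.norm_eq_abs, sq_abs, mul_pow]
  calc ((n : ℝ)⁻¹) ^ 2 * (∑ k ∈ Finset.range n, a k) ^ 2
      ≤ ((n : ℝ)⁻¹) ^ 2 * (n * ∑ k ∈ Finset.range n, a k ^ 2) := by gcongr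
    _ = (n : ℝ)⁻¹ * ∑ k ∈ Finset.range n, a k ^ 2 := by field_simp

/-- A form of the **RAGE theorem** for isometries and compact observables. -/
theorem lp.tendsto_cesaro_norm_isCompactOperator (V : ℋ →ₗᵢ[ℂ] ℋ) {ψ : ℋ}
    (hψ : ψ ∈ (⨆ c : ℂ, Module.End.eigenspace V.toLinearMap c)ᗮ) {K : ℋ →L[ℂ] ℋ}
    (hK : IsCompactOperator K) :
    Tendsto (fun n : ℕ => (n : ℝ)⁻¹ * ∑ k ∈ Finset.range n, ‖K (V^[k] ψ)‖)
      atTop (𝓝 0) := by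
  have hnorm : ∀ k, ‖V^[k] ψ‖ = ‖ψ‖ := by
    intro k
    induction k with
    | zero => rfl
    | succ k ih => rw [Function.iterate_succ_apply', V.norm_map, ih]
  apply tendsto_cesaro_of_sq
  set M := ‖K‖ * ‖ψ‖
  have hM : 0 ≤ M := by positivity
  have hKM : ∀ k, ‖K (V^[k] ψ)‖ ≤ M := fun k => (K.le_opNorm _).trans_eq (by rw [hnorm])
  have hbound : ∀ δ > 0, ∃ t : Finset ℋ, ∀ k,
      ‖K (V^[k] ψ)‖ ^ 2 ≤ M * δ + ∑ y ∈ t, ‖⟪K.adjoint y, V^[k] ψ⟫‖ := by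
    intro δ hδ
    have hcpt := hK.isCompact_closure_image_closedBall (f := K.toLinearMap) ‖ψ‖
    obtain ⟨t, -, htf, ht⟩ := hcpt.finite_cover_balls hδ
    refine ⟨htf.toFinset, fun k => ?_⟩
    have hmem : K (V^[k] ψ) ∈ ⋃ y ∈ t, Metric.ball y δ :=
      ht (subset_closure ⟨_, by simp [hnorm], rfl⟩)
    simp only [Set.mem_iUnion, Metric.mem_ball, dist_eq_norm] at hmem
    obtain ⟨y, hy, hyk⟩ := hmem
    have hsum : ‖⟪K.adjoint y, V^[k] ψ⟫‖ ≤
        ∑ y ∈ htf.toFinset, ‖⟪K.adjoint y, V^[k] ψ⟫‖ :=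
      Finset.single_le_sum (f := fun y => ‖⟪K.adjoint y, V^[k] ψ⟫‖)
        (fun _ _ => norm_nonneg _) (htf.mem_toFinset.2 hy)
    calc ‖K (V^[k] ψ)‖ ^ 2 = ‖⟪K (V^[k] ψ), K (V^[k] ψ)⟫‖ := by
          rw [inner_self_eq_norm_sq_to_K (𝕜 := ℂ)]; simp
      _ = ‖⟪K (V^[k] ψ) - y, K (V^[k] ψ)⟫ + ⟪y, K (V^[k] ψ)⟫‖ := by
          rw [← inner_add_left, sub_add_cancel]
      _ ≤ ‖K (V^[k] ψ) - y‖ * ‖K (V^[k] ψ)‖ + ‖⟪y, K (V^[k] ψ)⟫‖ :=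
          (norm_add_le _ _).trans (by gcongr; exact norm_inner_le_norm _ _)
      _ ≤ δ * M + ‖⟪K.adjoint y, V^[k] ψ⟫‖ := by
          rw [ContinuousLinearMap.adjoint_inner_left]
          gcongr
          exact hKM k
      _ ≤ _ := by rw [mul_comm]; gcongr
  rw [Metric.tendsto_atTop]
  intro ε hε
  obtain ⟨t, ht⟩ := hbound (ε / (2 * (M + 1))) (by positivity)
  have hlim : Tendsto (fun n : ℕ => ∑ y ∈ t, (n : ℝ)⁻¹ *
      ∑ k ∈ Finset.range n, ‖⟪K.adjoint y, V^[k] ψ⟫‖) atTop (𝓝 0) := by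
    simpa using tendsto_finsetSum t fun y _ =>
      tendsto_cesaro_of_sq (lp.tendsto_cesaro_norm_inner_sq V hψ _)
  obtain ⟨N, hN⟩ := Metric.tendsto_atTop.1 hlim (ε / 2) (by positivity)
  refine ⟨N + 1, fun n hn => ?_⟩
  have hn0 : (0 : ℝ) < n := by exact_mod_cast (Nat.succ_pos N).trans_le hn
  have h1 := hN n (by omega)
  have hMδ : M * (ε / (2 * (M + 1))) ≤ ε / 2 := by
    rw [← mul_div_assoc, div_le_div_iff₀ (by positivity) (by positivity)]
    nlinarith
  rw [Real.dist_0_eq_abs, abs_of_nonneg (by positivity)] at h1 ⊢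
  calc (n : ℝ)⁻¹ * ∑ k ∈ Finset.range n, ‖K (V^[k] ψ)‖ ^ 2
      ≤ (n : ℝ)⁻¹ * ∑ k ∈ Finset.range n, (M * (ε / (2 * (M + 1))) +
          ∑ y ∈ t, ‖⟪K.adjoint y, V^[k] ψ⟫‖) := by
        gcongr with k _
        exact ht k
    _ = M * (ε / (2 * (M + 1))) + ∑ y ∈ t, (n : ℝ)⁻¹ *
          ∑ k ∈ Finset.range n, ‖⟪K.adjoint y, V^[k] ψ⟫‖ := by
        rw [Finset.sum_add_distrib, Finset.sum_comm, mul_add, Finset.sum_const,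
          Finset.card_range, nsmul_eq_mul, inv_mul_cancel_left₀ hn0.ne', Finset.mul_sum]
    _ < ε := by linarith

end RAGE

section Multiplication

open Topology

variable {ι : Type*}

local notation "ℋ" => lp (fun _ : ι => ℂ) 2

/-- `η = m φ` for the (possibly unbounded) operator of multiplication by `m : ι → ℝ`:
`φ` is in the maximal domain and is mapped to `η`. -/
def lp.IsMul (m : ι → ℝ) (φ η : ℋ) : Prop := ∀ i, η i = m i * φ i

variable {m : ι → ℝ}

theorem lp.IsMul.inner_comm {φ φ' η η' : ℋ} (h : lp.IsMul m φ η) (h' : lp.IsMul m φ' η') :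
    ⟪η, φ'⟫ = ⟪φ, η'⟫ := by
  simp only [lp.inner_eq_tsum, RCLike.inner_apply]
  refine tsum_congr fun i => ?_
  rw [h i, h' i, map_mul, Complex.conj_ofReal]
  ring

theorem lp.IsMul.tsum_sq {φ η : ℋ} (h : lp.IsMul m φ η) :
    ∑' i, m i ^ 2 * ‖φ i‖ ^ 2 = ‖η‖ ^ 2 := by
  have := lp.norm_rpow_eq_tsum (p := 2) (by simp) η
  simp only [ENNReal.toReal_ofNat, Real.rpow_ofNat] at this
  rw [this]
  refine tsum_congr fun i => ?_
  rw [h i, norm_mul, mul_pow, Complex.norm_real, Real.norm_eq_abs, sq_abs]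

/-- The first-order commutation relation, from its weak form. -/
theorem lp.IsMul.map_of_commutator {φ η : ℋ} {B C : ℋ →L[ℂ] ℋ}
    (hBC : ∀ φ ψ φ' ψ', lp.IsMul m φ φ' → lp.IsMul m ψ ψ' →
      ⟪φ', B ψ⟫ - ⟪φ, B ψ'⟫ = ⟪φ, C ψ⟫) (h : lp.IsMul m φ η) :
    lp.IsMul m (B φ) (B η + C φ) := by
  classical
  intro i
  have h1 : lp.IsMul m (lp.single 2 i (1 : ℂ) : ℋ) (lp.single 2 i (m i : ℂ)) := by
    intro j
    by_cases hj : j = i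
    · subst hj; simp
    · simp [hj]
  have := hBC _ _ _ _ h1 h
  simp only [lp.inner_single_left, RCLike.inner_apply, Complex.conj_ofReal, map_one,
    mul_one] at this
  rw [lp.coeFn_add, Pi.add_apply, ← this]
  ring

theorem lp.IsMul.re_inner {φ η : ℋ} (h : lp.IsMul m φ η) :
    (⟪φ, η⟫).re = ∑' i, m i * ‖φ i‖ ^ 2 := by
  rw [← Complex.ofReal_re (∑' i, m i * ‖φ i‖ ^ 2), Complex.ofReal_tsum, lp.inner_eq_tsum]
  congr 1
  refine tsum_congr fun i => ?_
  rw [RCLike.inner_apply, h i, mul_assoc, Complex.mul_conj, Complex.normSq_eq_norm_sq]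
  push_cast
  rfl

theorem lp.IsMul.unique {φ η η' : ℋ} (h : lp.IsMul m φ η) (h' : lp.IsMul m φ η') : η = η' :=
  lp.ext (funext fun i => (h i).trans (h' i).symm)

theorem lp.IsMul.sum {κ : Type*} {s : Finset κ} {c : κ → ℝ} {m : κ → ι → ℝ} {φ : ℋ} {η : κ → ℋ}
    (h : ∀ k ∈ s, lp.IsMul (m k) φ (η k)) :
    lp.IsMul (fun i => ∑ k ∈ s, c k * m k i) φ (∑ k ∈ s, (c k : ℂ) • η k) := by
  intro i
  simp only [lp.coeFn_sum, Finset.sum_apply, lp.coeFn_smul, Pi.smul_apply, smul_eq_mul]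
  push_cast
  rw [Finset.sum_mul]
  refine Finset.sum_congr rfl fun k hk => ?_
  rw [h k hk i, mul_assoc]

theorem lp.isMul_sum_single [DecidableEq ι] (s : Finset ι) (f : ι → ℂ) :
    lp.IsMul m (∑ i ∈ s, lp.single 2 i (f i) : ℋ) (∑ i ∈ s, lp.single 2 i (m i * f i)) := by
  intro j
  simp only [lp.coeFn_sum, Finset.sum_apply, lp.single_apply, Pi.single_apply, Finset.mul_sum,
    mul_ite, mul_zero]
  refine Finset.sum_congr rfl fun i _ => ?_
  by_cases hj : j = i
  · subst hj; simp
  · simp [hj]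

theorem lp.tendsto_sum_single [DecidableEq ι] (φ : ℋ) :
    Tendsto (fun s : Finset ι => (∑ i ∈ s, lp.single 2 i (φ i) : ℋ)) atTop (𝓝 φ) :=
  lp.hasSum_single (by simp) φ

/-- If `B` is an isometry whose commutators with `m` and `m²` are bounded, then the quadratic
form of `m²` changes under `B` by that of the bounded operator `[m², B]`. -/
theorem lp.IsMul.norm_sq_map {B D E : ℋ →L[ℂ] ℋ} (hB : ∀ x y, ⟪B x, B y⟫ = ⟪x, y⟫)
    (hD : ∀ φ η, lp.IsMul m φ η → lp.IsMul m (B φ) (B η + D φ))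
    (hE : ∀ φ η, lp.IsMul (fun i => m i ^ 2) φ η → lp.IsMul (fun i => m i ^ 2) (B φ) (B η + E φ))
    {φ η η' : ℋ} (h : lp.IsMul m φ η) (h' : lp.IsMul m (B φ) η') :
    ‖η'‖ ^ 2 = ‖η‖ ^ 2 + (⟪B φ, E φ⟫).re := by
  classical
  rw [h'.unique (hD _ _ h)]
  have key : ∀ s : Finset ι,
      ‖B (∑ i ∈ s, lp.single 2 i (η i)) + D (∑ i ∈ s, lp.single 2 i (φ i))‖ ^ 2 =
        ‖(∑ i ∈ s, lp.single 2 i (η i) : ℋ)‖ ^ 2 +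
          (⟪B (∑ i ∈ s, lp.single 2 i (φ i)), E (∑ i ∈ s, lp.single 2 i (φ i))⟫).re := by
    intro s
    set φs : ℋ := ∑ i ∈ s, lp.single 2 i (φ i)
    set ηs : ℋ := ∑ i ∈ s, lp.single 2 i (η i)
    set ζs : ℋ := ∑ i ∈ s, lp.single 2 i (m i * η i)
    have h1 : lp.IsMul m φs ηs := by
      have := lp.isMul_sum_single (m := m) s φ
      simp only [← h _] at this
      exact this
    have h2 : lp.IsMul m ηs ζs := lp.isMul_sum_single s η
    have h3 := hD _ _ h1
    have h4 : lp.IsMul m (B ηs + D φs) (B ζs + E φs) := by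
      intro i
      rw [hE φs ζs (fun j => by rw [h2 j, h1 j]; push_cast; ring) i, h3 i]
      push_cast
      ring
    rw [← inner_self_eq_norm_sq (𝕜 := ℂ), ← inner_self_eq_norm_sq (𝕜 := ℂ), h3.inner_comm h4,
      h1.inner_comm h2, inner_add_right, hB]
    simp
  have hφ := lp.tendsto_sum_single φ
  have hη := lp.tendsto_sum_single η
  have hBη := (B.continuous.tendsto _).comp hη
  have hBφ := (B.continuous.tendsto _).comp hφ
  have hDφ := (D.continuous.tendsto _).comp hφ
  have hEφ := (E.continuous.tendsto _).comp hφ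
  refine tendsto_nhds_unique ((hBη.add hDφ).norm.pow 2) ?_
  refine ((hη.norm.pow 2).add ((Complex.continuous_re.tendsto _).comp
    (hBφ.inner (𝕜 := ℂ) hEφ))).congr fun s => (key s).symm

theorem lp.inner_translate [AddGroup ι] {T : ℋ →L[ℂ] ℋ} {a : ι}
    (hT : ∀ φ i, T φ i = φ (i + a)) (φ ψ : ℋ) : ⟪T φ, T ψ⟫ = ⟪φ, ψ⟫ := by
  rw [lp.inner_eq_tsum, lp.inner_eq_tsum, ← (Equiv.addRight a).tsum_eq fun i => ⟪φ i, ψ i⟫]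
  simp [hT]

theorem lp.IsMul.translate [AddGroup ι] {T : ℋ →L[ℂ] ℋ} {a : ι}
    (hT : ∀ φ i, T φ i = φ (i + a)) {r : ℝ} (hm : ∀ i, m (i + a) = m i + r) {φ η : ℋ}
    (h : lp.IsMul m φ η) : lp.IsMul m (T φ) (T (η - (r : ℂ) • φ)) := by
  intro i
  simp only [hT, lp.coeFn_sub, lp.coeFn_smul, Pi.sub_apply, Pi.smul_apply, smul_eq_mul, h _, hm]
  push_cast
  ring

/-- One step of the evolution of the second moment of `m`. -/
theorem lp.IsMul.norm_sq_translate_map [AddGroup ι] {T U C E : ℋ →L[ℂ] ℋ} {a : ι}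
    (hT : ∀ φ i, T φ i = φ (i + a)) {r : ℝ} (hm : ∀ i, m (i + a) = m i + r)
    (hU : ∀ x y, ⟪U x, U y⟫ = ⟪x, y⟫)
    (hC : ∀ φ η, lp.IsMul m φ η → lp.IsMul m (U φ) (U η + C φ))
    (hE : ∀ φ η, lp.IsMul (fun i => m i ^ 2) φ η →
      lp.IsMul (fun i => m i ^ 2) ((T * U) φ) ((T * U) η + E φ))
    {φ η η' : ℋ} (h : lp.IsMul m φ η) (h' : lp.IsMul m (U φ) η') :
    ‖η'‖ ^ 2 = ‖η‖ ^ 2 + 2 * (r * (⟪U φ, η'⟫).re) - r ^ 2 * ‖φ‖ ^ 2 +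
      (⟪(T * U) φ, E φ⟫).re := by
  have hV : ∀ x y, ⟪(T * U) x, (T * U) y⟫ = ⟪x, y⟫ := fun x y =>
    (lp.inner_translate hT _ _).trans (hU x y)
  have hD : ∀ φ η, lp.IsMul m φ η →
      lp.IsMul m ((T * U) φ) ((T * U) η + (T * (C - (r : ℂ) • U)) φ) := by
    intro φ η h
    have := (hC φ η h).translate hT hm
    have h2 : U η + C φ - (r : ℂ) • U φ = U η + (C - (r : ℂ) • U) φ := by
      rw [_root_.sub_apply, _root_.smul_apply, add_sub_assoc]
    rwa [h2, map_add] at this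
  have h1 := lp.IsMul.norm_sq_map hV hD hE h (h'.translate hT hm)
  have h2 : ‖T (η' - (r : ℂ) • U φ)‖ ^ 2 =
      ‖η'‖ ^ 2 - 2 * (r * (⟪U φ, η'⟫).re) + r ^ 2 * ‖φ‖ ^ 2 := by
    have hn : ∀ x : ℋ, (⟪x, x⟫).re = ‖x‖ ^ 2 := fun x => inner_self_eq_norm_sq (𝕜 := ℂ) x
    have hs : (⟪η', U φ⟫).re = (⟪U φ, η'⟫).re := inner_re_symm (𝕜 := ℂ) _ _
    rw [← hn, lp.inner_translate hT]
    simp only [inner_sub_left, inner_sub_right, inner_smul_left, inner_smul_right, hU,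
      Complex.conj_ofReal, Complex.sub_re, Complex.re_ofReal_mul, hn, hs]
    ring
  linarith

/-- One step of the evolution of the first moment of `m`. -/
theorem lp.IsMul.re_inner_map [AddGroup ι] {T U B : ℋ →L[ℂ] ℋ} {a : ι}
    (hT : ∀ φ i, T φ i = φ (i + a)) (hU : ∀ x y, ⟪U x, U y⟫ = ⟪x, y⟫)
    (hB : ∀ φ η, lp.IsMul m φ η → lp.IsMul m (U φ) (U η + B φ)) (c : ℝ)
    {φ η η' : ℋ} (h : lp.IsMul m φ η) (h' : lp.IsMul m (U φ) η') :
    |(⟪U φ, η'⟫).re - (⟪φ, η⟫).re - c * ‖φ‖ ^ 2| ≤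
      ‖φ‖ * ‖(T * B - (c : ℂ) • (T * U)) φ‖ := by
  have hV : ∀ x y, ⟪(T * U) x, (T * U) y⟫ = ⟪x, y⟫ := fun x y =>
    (lp.inner_translate hT _ _).trans (hU x y)
  have hn : ∀ x : ℋ, (⟪x, x⟫).re = ‖x‖ ^ 2 := fun x => inner_self_eq_norm_sq (𝕜 := ℂ) x
  have h1 : (⟪(T * U) φ, (T * B - (c : ℂ) • (T * U)) φ⟫).re =
      (⟪U φ, η'⟫).re - (⟪φ, η⟫).re - c * ‖φ‖ ^ 2 := by
    rw [h'.unique (hB _ _ h), inner_add_right, hU]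
    simp only [_root_.sub_apply, _root_.smul_apply, inner_sub_right, inner_smul_right, hV,
      Complex.sub_re, Complex.add_re, Complex.re_ofReal_mul, hn]
    rw [mul_apply_eq_comp, mul_apply_eq_comp, lp.inner_translate hT]
    ring
  have h2 : ‖(T * U) φ‖ = ‖φ‖ := by
    rw [← sq_eq_sq₀ (norm_nonneg _) (norm_nonneg _), ← hn, hV, hn]
  rw [← h1, ← h2]
  exact (Complex.abs_re_le_norm _).trans (norm_inner_le_norm _ _)

end Multiplication

theorem ContinuousLinearMap.iSup_eigenspace_star_le {E : Type*} [NormedAddCommGroup E]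
    [InnerProductSpace ℂ E] [CompleteSpace E] {U : E →L[ℂ] E} (hU : U * star U = 1) :
    ⨆ c : ℂ, Module.End.eigenspace (star U : E →L[ℂ] E).toLinearMap c ≤
      ⨆ c : ℂ, Module.End.eigenspace U.toLinearMap c := by
  refine iSup_le fun c => le_trans (fun v hv => ?_) (le_iSup _ c⁻¹)
  rw [Module.End.mem_eigenspace_iff] at hv ⊢
  have hv' : star U v = c • v := hv
  have h1 : U (c • v) = v := by rw [← hv', ← mul_apply_eq_comp, hU]; rfl
  rw [map_smul] at h1
  change U v = c⁻¹ • v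
  rcases eq_or_ne c 0 with rfl | hc
  · rw [zero_smul] at h1
    simp [← h1]
  · rw [eq_inv_smul_iff₀ hc, h1]

theorem lp.exists_isMul_of_memDX {d : ℕ} {φ : l2Zd d} (h : memDX φ) :
    ∃ ξ : Fin d → l2Zd d, ∀ j, lp.IsMul (fun β : Fin d → ℤ => (β j : ℝ)) φ (ξ j) :=
  ⟨fun j => ⟨_, h j⟩, fun j β => by simp⟩

theorem xNormSq_eq {d : ℕ} {φ : l2Zd d} {ξ : Fin d → l2Zd d}
    (h : ∀ j, lp.IsMul (fun β : Fin d → ℤ => (β j : ℝ)) φ (ξ j)) :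
    xNormSq φ = ‖φ‖ ^ 2 + ∑ j, ‖ξ j‖ ^ 2 := by
  rw [xNormSq]
  congr 1
  exact Finset.sum_congr rfl fun j _ => (h j).tsum_sq

/-- One step of the evolution of the weighted norm. -/
theorem abs_xNormSq_map_sub_le {d : ℕ} {α : Fin d → ℤ} {T U : l2Zd d →L[ℂ] l2Zd d}
    {C E : Fin d → (l2Zd d →L[ℂ] l2Zd d)}
    (hT : ∀ (φ : l2Zd d) (β : Fin d → ℤ), (T φ) β = φ (β + α))
    (hU : ∀ x y, ⟪U x, U y⟫ = ⟪x, y⟫)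
    (hC : ∀ j φ η, lp.IsMul (fun β : Fin d → ℤ => (β j : ℝ)) φ η →
      lp.IsMul (fun β : Fin d → ℤ => (β j : ℝ)) (U φ) (U η + C j φ))
    (hE : ∀ j φ η, lp.IsMul (fun β : Fin d → ℤ => (β j : ℝ) ^ 2) φ η →
      lp.IsMul (fun β : Fin d → ℤ => (β j : ℝ) ^ 2) ((T * U) φ) ((T * U) η + E j φ))
    {φ : l2Zd d} (hφ : memDX φ) (hUφ : memDX (U φ)) :
    |xNormSq (U φ) - xNormSq φ -
        2 * ∑' β : Fin d → ℤ, (∑ j, (α j : ℝ) * β j) * ‖U φ β‖ ^ 2| ≤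
      (∑ j, (α j : ℝ) ^ 2 + ∑ j, ‖E j‖) * ‖φ‖ ^ 2 := by
  obtain ⟨ξ, hξ⟩ := lp.exists_isMul_of_memDX hφ
  obtain ⟨ξ', hξ'⟩ := lp.exists_isMul_of_memDX hUφ
  have hn : ∀ x : l2Zd d, (⟪x, x⟫).re = ‖x‖ ^ 2 := fun x => inner_self_eq_norm_sq (𝕜 := ℂ) x
  have hUn : ∀ x, ‖U x‖ = ‖x‖ := fun x => by
    rw [← sq_eq_sq₀ (norm_nonneg _) (norm_nonneg _), ← hn, hU, hn]
  have hTn : ∀ x, ‖T x‖ = ‖x‖ := fun x => by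
    rw [← sq_eq_sq₀ (norm_nonneg _) (norm_nonneg _), ← hn, lp.inner_translate hT, hn]
  have h1 := fun j => lp.IsMul.norm_sq_translate_map hT (r := α j)
    (fun β => by simp) hU (hC j) (hE j) (hξ j) (hξ' j)
  have h2 : ∑' β : Fin d → ℤ, (∑ j, (α j : ℝ) * β j) * ‖U φ β‖ ^ 2 =
      ∑ j, (α j : ℝ) * (⟪U φ, ξ' j⟫).re := by
    rw [← (lp.IsMul.sum (s := Finset.univ) (c := fun j => (α j : ℝ)) fun j _ => hξ' j).re_inner]
    simp
  have h3 : ∀ j, |(⟪(T * U) φ, E j φ⟫).re| ≤ ‖E j‖ * ‖φ‖ ^ 2 := fun j =>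
    calc |(⟪(T * U) φ, E j φ⟫).re| ≤ ‖(T * U) φ‖ * ‖E j φ‖ :=
          (Complex.abs_re_le_norm _).trans (norm_inner_le_norm _ _)
      _ ≤ ‖φ‖ * (‖E j‖ * ‖φ‖) := by
          rw [mul_apply_eq_comp, hTn, hUn]
          gcongr
          exact (E j).le_opNorm φ
      _ = ‖E j‖ * ‖φ‖ ^ 2 := by ring
  rw [xNormSq_eq hξ, xNormSq_eq hξ', hUn, h2, Finset.sum_congr rfl fun j _ => h1 j]
  simp only [Finset.sum_add_distrib, Finset.sum_sub_distrib, ← Finset.mul_sum, ← Finset.sum_mul]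
  rw [show ∀ a b c e f : ℝ, a + (b + 2 * c - e + f) - (a + b) - 2 * c = f - e by intros; ring]
  refine (abs_sub _ _).trans ?_
  rw [abs_of_nonneg (by positivity : 0 ≤ (∑ j, (α j : ℝ) ^ 2) * ‖φ‖ ^ 2), add_comm, add_mul]
  gcongr
  refine (Finset.abs_sum_le_sum_abs _ _).trans ?_
  rw [Finset.sum_mul]
  exact Finset.sum_le_sum fun j _ => h3 j

/-- One step of the evolution of the first moment in the direction of the translation. -/
theorem abs_tsum_map_sub_le {d : ℕ} {α : Fin d → ℤ} {T U B : l2Zd d →L[ℂ] l2Zd d}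
    (hT : ∀ (φ : l2Zd d) (β : Fin d → ℤ), (T φ) β = φ (β + α))
    (hU : ∀ x y, ⟪U x, U y⟫ = ⟪x, y⟫)
    (hB : ∀ φ η, lp.IsMul (fun β : Fin d → ℤ => ∑ j, (α j : ℝ) * β j) φ η →
      lp.IsMul (fun β : Fin d → ℤ => ∑ j, (α j : ℝ) * β j) (U φ) (U η + B φ)) (c : ℝ)
    {φ : l2Zd d} (hφ : memDX φ) (hUφ : memDX (U φ)) :
    |∑' β : Fin d → ℤ, (∑ j, (α j : ℝ) * β j) * ‖U φ β‖ ^ 2 -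
        ∑' β : Fin d → ℤ, (∑ j, (α j : ℝ) * β j) * ‖φ β‖ ^ 2 - c * ‖φ‖ ^ 2| ≤
      ‖φ‖ * ‖(T * B - (c : ℂ) • (T * U)) φ‖ := by
  obtain ⟨ξ, hξ⟩ := lp.exists_isMul_of_memDX hφ
  obtain ⟨ξ', hξ'⟩ := lp.exists_isMul_of_memDX hUφ
  have h := lp.IsMul.sum (s := Finset.univ) (c := fun j => (α j : ℝ)) fun j _ => hξ j
  have h' := lp.IsMul.sum (s := Finset.univ) (c := fun j => (α j : ℝ)) fun j _ => hξ' j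
  rw [← h.re_inner, ← h'.re_inner]
  exact lp.IsMul.re_inner_map hT hU hB c h h'

/-- Proposition 5.3 ("laurent-2tr"): let `α ∈ ℤ^d \ {0}` and let `A` be multiplication by
`α·β`. If a unitary `U` belongs to `∩_j C¹(X_j) ∩ C¹(A)`, `T^{−α}U ∈ ∩_j C¹(X_j²)`, and
`ad_A(T^{−α}U) = T^{−α}B_U − |α|²T^{−α}U` is compact, then for every
`ψ ∈ H_c(U) ∩ D_X` one has `n⁻¹‖U^{±n}ψ‖_X → |α|·‖ψ‖`. -/
theorem stmt19 (d : ℕ) (α : Fin d → ℤ) (hα : α ≠ 0)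
    (U : l2Zd d →L[ℂ] l2Zd d) (hU : U ∈ unitary (l2Zd d →L[ℂ] l2Zd d))
    -- (1) U is of class C¹(X_j) for each j; U and U* preserve D_X
    (CX : Fin d → (l2Zd d →L[ℂ] l2Zd d))
    (hCX : ∀ (j : Fin d) (φ ψ : l2Zd d)
      (hφ : Memℓp (fun β : Fin d → ℤ => ((β j : ℤ) : ℂ) * φ β) 2)
      (hψ : Memℓp (fun β : Fin d → ℤ => ((β j : ℤ) : ℂ) * ψ β) 2),
      ⟪(⟨fun β => ((β j : ℤ) : ℂ) * φ β, hφ⟩ : l2Zd d), U ψ⟫ -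
        ⟪φ, U (⟨fun β => ((β j : ℤ) : ℂ) * ψ β, hψ⟩ : l2Zd d)⟫ = ⟪φ, CX j ψ⟫)
    (hUD : ∀ φ : l2Zd d, memDX φ → memDX (U φ) ∧ memDX ((star U) φ))
    -- (2) U is of class C¹(A) with commutator BU, A being multiplication by α·β
    (BU : l2Zd d →L[ℂ] l2Zd d)
    (hC1 : ∀ (φ ψ : l2Zd d)
      (hφ : Memℓp (fun β : Fin d → ℤ => ((∑ j, α j * β j : ℤ) : ℂ) * φ β) 2)
      (hψ : Memℓp (fun β : Fin d → ℤ => ((∑ j, α j * β j : ℤ) : ℂ) * ψ β) 2),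
      ⟪(⟨fun β => ((∑ j, α j * β j : ℤ) : ℂ) * φ β, hφ⟩ : l2Zd d), U ψ⟫ -
        ⟪φ, U (⟨fun β => ((∑ j, α j * β j : ℤ) : ℂ) * ψ β, hψ⟩ : l2Zd d)⟫ =
      ⟪φ, BU ψ⟫)
    -- T^{−α}
    (Tma : l2Zd d →L[ℂ] l2Zd d)
    (hTma : ∀ (φ : l2Zd d) (β : Fin d → ℤ), (Tma φ) β = φ (β + α))
    -- (3) T^{−α}U is of class C¹(X_j²) for each j
    (CXX : Fin d → (l2Zd d →L[ℂ] l2Zd d))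
    (hCXX : ∀ (j : Fin d) (φ ψ : l2Zd d)
      (hφ : Memℓp (fun β : Fin d → ℤ => (((β j : ℤ) : ℂ)) ^ 2 * φ β) 2)
      (hψ : Memℓp (fun β : Fin d → ℤ => (((β j : ℤ) : ℂ)) ^ 2 * ψ β) 2),
      ⟪(⟨fun β => (((β j : ℤ) : ℂ)) ^ 2 * φ β, hφ⟩ : l2Zd d), (Tma * U) ψ⟫ -
        ⟪φ, (Tma * U) (⟨fun β => (((β j : ℤ) : ℂ)) ^ 2 * ψ β, hψ⟩ : l2Zd d)⟫ =
      ⟪φ, CXX j ψ⟫)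
    -- (4) ad_A(T^{−α}U) = T^{−α}B_U − |α|²·T^{−α}U is compact
    (hcomp : IsCompactOperator
      ⇑(Tma * BU - ((∑ j, (α j) ^ 2 : ℤ) : ℂ) • (Tma * U))) :
    -- conclusion: ballistic propagation on H_c(U) ∩ D_X
    ∀ ψ : l2Zd d, memDX ψ →
      ψ ∈ (⨆ c : ℂ, Module.End.eigenspace (U : l2Zd d →ₗ[ℂ] l2Zd d) c)ᗮ →
      Tendsto (fun n : ℕ => (n : ℝ)⁻¹ * Real.sqrt (xNormSq ((U ^ n) ψ)))
          atTop (nhds (Real.sqrt ((∑ j, (α j) ^ 2 : ℤ) : ℝ) * ‖ψ‖)) ∧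
      Tendsto (fun n : ℕ => (n : ℝ)⁻¹ * Real.sqrt (xNormSq (((star U) ^ n) ψ)))
          atTop (nhds (Real.sqrt ((∑ j, (α j) ^ 2 : ℤ) : ℝ) * ‖ψ‖)) := by
  intro ψ hψ hψc
  have hUU : ∀ φ, star U (U φ) = φ := fun φ => by
    rw [← mul_apply_eq_comp, Unitary.star_mul_self_of_mem hU]; rfl
  have hUU' : ∀ φ, U (star U φ) = φ := fun φ => by
    rw [← mul_apply_eq_comp, Unitary.mul_star_self_of_mem hU]; rfl
  have hinner : ∀ x y, ⟪U x, U y⟫ = ⟪x, y⟫ := fun x y => by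
    rw [← ContinuousLinearMap.adjoint_inner_left, ← ContinuousLinearMap.star_eq_adjoint, hUU]
  have hnorm : ∀ x, ‖U x‖ = ‖x‖ := fun x => by
    rw [norm_eq_sqrt_re_inner (𝕜 := ℂ), hinner, ← norm_eq_sqrt_re_inner]
  have hnorm' : ∀ x, ‖star U x‖ = ‖x‖ := fun x => by rw [← hnorm, hUU']
  have hC : ∀ j φ η, lp.IsMul (fun β : Fin d → ℤ => (β j : ℝ)) φ η →
      lp.IsMul (fun β : Fin d → ℤ => (β j : ℝ)) (U φ) (U η + CX j φ) := by
    intro j φ η h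
    refine lp.IsMul.map_of_commutator (fun x y x' y' hx hy => ?_) h
    have ex : ⇑x' = fun β : Fin d → ℤ => ((β j : ℤ) : ℂ) * x β := funext fun β => by simp [hx β]
    have ey : ⇑y' = fun β : Fin d → ℤ => ((β j : ℤ) : ℂ) * y β := funext fun β => by simp [hy β]
    convert hCX j x y (ex ▸ lp.memℓp x') (ey ▸ lp.memℓp y') using 3
    · exact lp.ext ex
    · exact congrArg U (lp.ext ey)
  have hB : ∀ φ η, lp.IsMul (fun β : Fin d → ℤ => ∑ j, (α j : ℝ) * β j) φ η →
      lp.IsMul (fun β : Fin d → ℤ => ∑ j, (α j : ℝ) * β j) (U φ) (U η + BU φ) := by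
    intro φ η h
    refine lp.IsMul.map_of_commutator (fun x y x' y' hx hy => ?_) h
    have ex : ⇑x' = fun β : Fin d → ℤ => ((∑ j, α j * β j : ℤ) : ℂ) * x β :=
      funext fun β => by simp [hx β]
    have ey : ⇑y' = fun β : Fin d → ℤ => ((∑ j, α j * β j : ℤ) : ℂ) * y β :=
      funext fun β => by simp [hy β]
    convert hC1 x y (ex ▸ lp.memℓp x') (ey ▸ lp.memℓp y') using 3
    · exact lp.ext ex
    · exact congrArg U (lp.ext ey)
  have hE : ∀ j φ η, lp.IsMul (fun β : Fin d → ℤ => (β j : ℝ) ^ 2) φ η →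
      lp.IsMul (fun β : Fin d → ℤ => (β j : ℝ) ^ 2) ((Tma * U) φ) ((Tma * U) η + CXX j φ) := by
    intro j φ η h
    refine lp.IsMul.map_of_commutator (fun x y x' y' hx hy => ?_) h
    have ex : ⇑x' = fun β : Fin d → ℤ => ((β j : ℤ) : ℂ) ^ 2 * x β :=
      funext fun β => by simp [hx β]
    have ey : ⇑y' = fun β : Fin d → ℤ => ((β j : ℤ) : ℂ) ^ 2 * y β :=
      funext fun β => by simp [hy β]
    convert hCXX j x y (ex ▸ lp.memℓp x') (ey ▸ lp.memℓp y') using 3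
    · exact lp.ext ex
    · exact congrArg (Tma * U) (lp.ext ey)
  set c : ℝ := ∑ j, (α j : ℝ) ^ 2 with hc
  have hcZ : ((∑ j, (α j) ^ 2 : ℤ) : ℝ) = c := by simp [hc]
  have hcC : ((∑ j, (α j) ^ 2 : ℤ) : ℂ) = (c : ℂ) := by simp [hc]
  rw [hcC] at hcomp
  rw [hcZ]
  set K : l2Zd d →L[ℂ] l2Zd d := Tma * BU - (c : ℂ) • (Tma * U)
  let p : l2Zd d → ℝ := fun φ => ∑' β : Fin d → ℤ, (∑ j, (α j : ℝ) * β j) * ‖φ β‖ ^ 2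
  set M : ℝ := c + ∑ j, ‖CXX j‖
  have stepp : ∀ φ, memDX φ → |p (U φ) - p φ - c * ‖φ‖ ^ 2| ≤ ‖φ‖ * ‖K φ‖ := fun φ hφ =>
    abs_tsum_map_sub_le hTma hinner hB c hφ (hUD φ hφ).1
  have stepq : ∀ φ, memDX φ → |xNormSq (U φ) - xNormSq φ - 2 * p (U φ)| ≤ M * ‖φ‖ ^ 2 :=
    fun φ hφ => abs_xNormSq_map_sub_le hTma hinner hC hE hφ (hUD φ hφ).1
  have hsqrt : √(c * ‖ψ‖ ^ 2) = √c * ‖ψ‖ := by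
    rw [Real.sqrt_mul' _ (sq_nonneg _), Real.sqrt_sq (norm_nonneg _)]
  have hpow : ∀ (W : l2Zd d →L[ℂ] l2Zd d) (n : ℕ), (W ^ (n + 1)) ψ = W ((W ^ n) ψ) :=
    fun W n => by rw [pow_succ', mul_apply_eq_comp]
  have hiter : ∀ (W : l2Zd d →ₗᵢ[ℂ] l2Zd d) (n : ℕ),
      W^[n] ψ = (W.toContinuousLinearMap ^ n) ψ := fun W n => by
    induction n with
    | zero => rfl
    | succ n ih => rw [Function.iterate_succ_apply', ih, hpow]; rfl
  have rage : ∀ (W L : l2Zd d →L[ℂ] l2Zd d), (∀ x, ‖W x‖ = ‖x‖) → IsCompactOperator L →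
      ψ ∈ (⨆ c : ℂ, Module.End.eigenspace (W : l2Zd d →ₗ[ℂ] l2Zd d) c)ᗮ →
      Tendsto (fun n : ℕ => (n : ℝ)⁻¹ * ∑ k ∈ Finset.range n, ‖ψ‖ * ‖L ((W ^ k) ψ)‖)
        atTop (nhds 0) := by
    intro W L hW hL hW'
    have := (lp.tendsto_cesaro_norm_isCompactOperator (⟨W, hW⟩ : l2Zd d →ₗᵢ[ℂ] l2Zd d)
      hW' hL).const_mul ‖ψ‖
    rw [mul_zero] at this
    refine this.congr fun n => ?_
    rw [← Finset.mul_sum, mul_left_comm]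
    simp only [hiter]
    rfl
  constructor
  · have hn : ∀ k, ‖(U ^ k) ψ‖ = ‖ψ‖ := fun k => by
      induction k with
      | zero => rfl
      | succ k ih => rw [hpow, hnorm, ih]
    have hD : ∀ k, memDX ((U ^ k) ψ) := fun k => by
      induction k with
      | zero => exact hψ
      | succ k ih => rw [hpow]; exact (hUD _ ih).1
    have hp : ∀ k, |p ((U ^ (k + 1)) ψ) - p ((U ^ k) ψ) - c * ‖ψ‖ ^ 2| ≤
        ‖ψ‖ * ‖K ((U ^ k) ψ)‖ := fun k => by
      simpa only [hpow, hn] using stepp _ (hD k)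
    have := tendsto_inv_mul_sqrt_of_recurrence (s := 0)
      (p := fun k => p ((U ^ k) ψ)) (q := fun k => xNormSq ((U ^ k) ψ))
      (M := M * ‖ψ‖ ^ 2 + 2 * (‖ψ‖ * (‖K‖ * ‖ψ‖) + |c * ‖ψ‖ ^ 2|))
      (rage U K hnorm hcomp hψc) hp fun k => by
        have h1 := hp k
        have h2 : |xNormSq ((U ^ (k + 1)) ψ) - xNormSq ((U ^ k) ψ) - 2 * p ((U ^ (k + 1)) ψ)| ≤
            M * ‖ψ‖ ^ 2 := by simpa only [hpow, hn] using stepq _ (hD k)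
        have h3 : ‖ψ‖ * ‖K ((U ^ k) ψ)‖ ≤ ‖ψ‖ * (‖K‖ * ‖ψ‖) := by
          rw [← hn k]
          gcongr
          exact K.le_opNorm _
        have h4 := neg_abs_le (c * ‖ψ‖ ^ 2)
        have h5 := le_abs_self (c * ‖ψ‖ ^ 2)
        rw [abs_le] at h1 h2 ⊢
        constructor <;> linarith [h1.1, h1.2, h2.1, h2.2]
    simpa only [zero_add, hsqrt] using this
  · have hn : ∀ k, ‖((star U) ^ k) ψ‖ = ‖ψ‖ := fun k => by
      induction k with
      | zero => rfl
      | succ k ih => rw [hpow, hnorm', ih]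
    have hD : ∀ k, memDX (((star U) ^ k) ψ) := fun k => by
      induction k with
      | zero => exact hψ
      | succ k ih => rw [hpow]; exact (hUD _ ih).2
    have hback : ∀ k, U (((star U) ^ (k + 1)) ψ) = ((star U) ^ k) ψ := fun k => by
      rw [hpow, hUU']
    have := tendsto_inv_mul_sqrt_of_recurrence (s := 0)
      (p := fun k => -p (((star U) ^ k) ψ)) (q := fun k => xNormSq (((star U) ^ k) ψ))
      (c := c * ‖ψ‖ ^ 2) (M := M * ‖ψ‖ ^ 2)
      (rage (star U) (K * star U) hnorm' (hcomp.comp_clm (star U))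
        (Submodule.orthogonal_le (ContinuousLinearMap.iSup_eigenspace_star_le
          (Unitary.mul_star_self_of_mem hU)) hψc)) (fun k => by
        have h1 := stepp _ (hD (k + 1))
        rw [hback, hn] at h1
        rw [mul_apply_eq_comp, ← hpow]
        refine le_of_eq_of_le ?_ h1
        congr 1
        ring) fun k => by
        have h1 := stepq _ (hD (k + 1))
        rw [hback, hn, abs_sub_comm] at h1
        refine le_of_eq_of_le ?_ h1
        congr 1
        ring
    simpa only [zero_add, hsqrt] using this
end
end
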